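/- arXiv:1306.0093 — 3 statements merged into one kernel-verified Lean document; each statement's English description precedes it below -/
import Mathlib

section
/- Let G be a connected graph with n vertices. Then for any 1 ≤ k ≤ n, S⁺_k(G) ≤ 2e(G) + 2k − n − (2k−2)/n. -/
open Matrix Polynomial

/-- Sum of the `k` largest entries of a finitely-indexed family of reals. -/
noncomputable def sumKLargest {V : Type*} [Fintype V] (v : V → ℝ) (k : ℕ) : ℝ :=
  (((Finset.univ.val.map v).toList.mergeSort (fun a b => decide (b ≤ a))).take k).sum

open Classical in
/-- The signless Laplacian matrix `Q(G) = D(G) + A(G)` of a simple graph. -/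
noncomputable def signlessLap {V : Type*} [Fintype V] [DecidableEq V]
    (G : SimpleGraph V) : Matrix V V ℝ :=
  G.degMatrix ℝ + G.adjMatrix ℝ

theorem signlessLap_isHermitian {V : Type*} [Fintype V] [DecidableEq V]
    (G : SimpleGraph V) : (signlessLap G).IsHermitian := by
  classical
  ext i j
  by_cases h : i = j
  · subst h; simp [signlessLap]
  · simp [signlessLap, Matrix.conjTranspose_apply, SimpleGraph.degMatrix,
      Matrix.diagonal_apply, h, Ne.symm h, SimpleGraph.adj_comm]

/-- `S⁺_k(G)`: the sum of the `k` largest signless Laplacian eigenvalues of `G`. -/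
noncomputable def Splus {V : Type*} [Fintype V] [DecidableEq V]
    (G : SimpleGraph V) (k : ℕ) : ℝ :=
  sumKLargest (signlessLap_isHermitian G).eigenvalues k

/-- `e(G)`: the number of edges of `G`. -/
noncomputable def numEdges {V : Type*} (G : SimpleGraph V) : ℕ := G.edgeSet.ncard

/-- The `0`-`1` vector of the endpoints of an edge. -/
noncomputable def edgeVec {V : Type*} [DecidableEq V] (e : Sym2 V) : V → ℝ :=
  fun a => if a ∈ e then 1 else 0

theorem edgeVec_mk_dotProduct {V : Type*} [Fintype V] [DecidableEq V] {a b : V} (h : a ≠ b)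
    (y : V → ℝ) : edgeVec s(a, b) ⬝ᵥ y = y a + y b := by
  have h1 : ∀ i, edgeVec s(a, b) i * y i
      = (if i = a then y i else 0) + (if i = b then y i else 0) := by
    intro i
    by_cases hia : i = a
    · subst hia; simp [edgeVec, h]
    · by_cases hib : i = b
      · subst hib; simp [edgeVec, hia]
      · simp [edgeVec, hia, hib]
  simp [dotProduct, h1, Finset.sum_add_distrib]

theorem edgeVec_dotProduct_self {V : Type*} [Fintype V] [DecidableEq V] {e : Sym2 V}
    (h : ¬ e.IsDiag) : edgeVec e ⬝ᵥ edgeVec e = 2 := by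
  induction e with
  | _ a b =>
    rw [Sym2.mk_isDiag_iff] at h
    rw [edgeVec_mk_dotProduct h]
    norm_num [edgeVec]

theorem dotProduct_vecMulVec_self_mulVec {V : Type*} [Fintype V] (p y : V → ℝ) :
    y ⬝ᵥ (vecMulVec p p *ᵥ y) = (p ⬝ᵥ y) ^ 2 := by
  rw [vecMulVec_mulVec, dotProduct_comm]
  simp [smul_dotProduct, sq]

theorem posSemidef_vecMulVec_self_real {V : Type*} [Finite V] (p : V → ℝ) :
    (vecMulVec p p).PosSemidef := by
  simpa using posSemidef_vecMulVec_self_star p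

theorem dotProduct_mulVec_nonneg_real {V : Type*} [Fintype V] {Z : Matrix V V ℝ}
    (hZ : Z.PosSemidef) (y : V → ℝ) : 0 ≤ y ⬝ᵥ (Z *ᵥ y) := by
  simpa using hZ.dotProduct_mulVec_nonneg y

theorem dotProduct_signlessLap_mulVec {V : Type*} [Fintype V] [DecidableEq V]
    (G : SimpleGraph V) [Fintype G.edgeSet] (y : V → ℝ) :
    y ⬝ᵥ (signlessLap G *ᵥ y) = ∑ e ∈ G.edgeFinset, (edgeVec e ⬝ᵥ y) ^ 2 := by
  classical
  have hQ : signlessLap G = G.incMatrix ℝ * (G.incMatrix ℝ)ᵀ := by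
    rw [SimpleGraph.incMatrix_mul_transpose]
    ext i j
    by_cases h : i = j
    · subst h
      simp [signlessLap, SimpleGraph.degMatrix]
    · simp [signlessLap, SimpleGraph.degMatrix, h, SimpleGraph.adjMatrix_apply]
  rw [hQ, ← mulVec_mulVec, dotProduct_mulVec, ← mulVec_transpose]
  rw [dotProduct, ← Finset.sum_subset (Finset.subset_univ G.edgeFinset)]
  · refine Finset.sum_congr rfl fun e he => ?_
    rw [← sq]
    congr 1
    refine Finset.sum_congr rfl fun a _ => ?_
    have : a ∈ e ↔ e ∈ G.incidenceSet a := by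
      simp [SimpleGraph.incidenceSet, SimpleGraph.mem_edgeFinset.1 he]
    simp [edgeVec, SimpleGraph.incMatrix_apply', this]
  · intro e _ he
    have : (G.incMatrix ℝ)ᵀ *ᵥ y = fun e => ∑ a, G.incMatrix ℝ a e * y a := rfl
    rw [this]
    have h0 : ∀ a, G.incMatrix ℝ a e = 0 := by
      intro a
      apply SimpleGraph.incMatrix_of_notMem_incidenceSet
      intro h
      exact he (SimpleGraph.mem_edgeFinset.2 h.1)
    simp [h0]

theorem sum_take_le_add_sum_posPart (l : List ℝ) (k : ℕ) {x : ℝ} (hx : 0 ≤ x) :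
    (l.take k).sum ≤ k * x + (l.map fun a => max (a - x) 0).sum := by
  induction l generalizing k with
  | nil => simp; positivity
  | cons a l ih =>
    cases k with
    | zero =>
      simp only [List.take_zero, List.sum_nil, Nat.cast_zero, zero_mul, zero_add]
      apply List.sum_nonneg
      simp
    | succ k =>
      have := ih k
      have h2 := le_max_left (a - x) 0
      simp only [List.take_succ_cons, List.sum_cons, List.map_cons]
      push_cast
      linarith

theorem sumKLargest_le_add_sum_posPart {V : Type*} [Fintype V] (v : V → ℝ) (k : ℕ) {x : ℝ}
    (hx : 0 ≤ x) : sumKLargest v k ≤ k * x + ∑ i, max (v i - x) 0 := by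
  refine (sum_take_le_add_sum_posPart _ k hx).trans_eq ?_
  congr 1
  rw [((List.mergeSort_perm _ _).map _).sum_eq]
  rw [← Multiset.sum_coe, ← Multiset.map_coe, Multiset.coe_toList, Multiset.map_map]
  rfl

/-- If `A ≤ x I + Z` with `Z` positive semidefinite, the sum of the `k` largest eigenvalues of `A`
is at most `k x + tr Z`. -/
theorem sumKLargest_eigenvalues_le {V : Type*} [Fintype V] [DecidableEq V]
    {A Z : Matrix V V ℝ} (hA : A.IsHermitian) (hZ : Z.PosSemidef) {x : ℝ} (hx : 0 ≤ x)
    (h : ∀ y : V → ℝ, y ⬝ᵥ (A *ᵥ y) ≤ x * (y ⬝ᵥ y) + y ⬝ᵥ (Z *ᵥ y)) (k : ℕ) :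
    sumKLargest hA.eigenvalues k ≤ k * x + Z.trace := by
  refine (sumKLargest_le_add_sum_posPart _ k hx).trans ?_
  gcongr
  have htr : Z.trace = ∑ i, (hA.eigenvectorBasis i).ofLp ⬝ᵥ
      (Z *ᵥ (hA.eigenvectorBasis i).ofLp) := by
    have hU : (hA.eigenvectorUnitary : Matrix V V ℝ) *
        star (hA.eigenvectorUnitary : Matrix V V ℝ) = 1 :=
      Unitary.coe_mul_star_self _
    calc Z.trace = (star (hA.eigenvectorUnitary : Matrix V V ℝ) *
          (Z * (hA.eigenvectorUnitary : Matrix V V ℝ))).trace := by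
          rw [trace_mul_comm, mul_assoc, hU, mul_one]
      _ = _ := by
          refine Finset.sum_congr rfl fun i _ => ?_
          simp [Matrix.diag, Matrix.mul_apply, dotProduct, mulVec, Matrix.star_apply]
  rw [htr]
  refine Finset.sum_le_sum fun i _ => max_le ?_ (dotProduct_mulVec_nonneg_real hZ _)
  have h1 := h (hA.eigenvectorBasis i).ofLp
  have hn : (hA.eigenvectorBasis i).ofLp ⬝ᵥ (hA.eigenvectorBasis i).ofLp = 1 := by
    have h2 := real_inner_self_eq_norm_sq (hA.eigenvectorBasis i)
    rw [hA.eigenvectorBasis.orthonormal.1 i, EuclideanSpace.inner_eq_star_dotProduct] at h2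
    simpa only [star_trivial, one_pow] using h2
  rw [hA.mulVec_eigenvectorBasis, dotProduct_smul, hn] at h1
  simp only [smul_eq_mul, mul_one] at h1
  linarith

/-- Vertex and edge sets of the trees obtained from vertex-disjoint nontrivial stars
by repeatedly joining two of them by an edge. -/
inductive IsStarTree {V : Type*} [DecidableEq V] : Finset V → Finset (Sym2 V) → Prop
  | star (c : V) (L : Finset V) (hc : c ∉ L) (hL : L.Nonempty) :
      IsStarTree (insert c L) (L.image fun l => s(c, l))
  | join {S₁ S₂ : Finset V} {E₁ E₂ : Finset (Sym2 V)} (u v : V) (h₁ : IsStarTree S₁ E₁)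
      (h₂ : IsStarTree S₂ E₂) (hd : Disjoint S₁ S₂) (hu : u ∈ S₁) (hv : v ∈ S₂) :
      IsStarTree (S₁ ∪ S₂) (insert s(u, v) (E₁ ∪ E₂))

namespace IsStarTree

variable {V : Type*} [DecidableEq V] {S : Finset V} {E : Finset (Sym2 V)}

theorem mem_of_mem (h : IsStarTree S E) {e : Sym2 V} (he : e ∈ E) {a : V} (ha : a ∈ e) :
    a ∈ S := by
  induction h generalizing e a with
  | star c L hc hL =>
    obtain ⟨l, hl, rfl⟩ := Finset.mem_image.1 he
    rcases Sym2.mem_iff.1 ha with rfl | rfl <;> simp [hl]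
  | join u v h₁ h₂ hd hu hv ih₁ ih₂ =>
    rw [Finset.mem_insert, Finset.mem_union] at he
    rw [Finset.mem_union]
    rcases he with rfl | he | he
    · rcases Sym2.mem_iff.1 ha with rfl | rfl <;> simp [hu, hv]
    · exact Or.inl (ih₁ he ha)
    · exact Or.inr (ih₂ he ha)

theorem two_le_card (h : IsStarTree S E) : 2 ≤ S.card := by
  induction h with
  | star c L hc hL =>
    rw [Finset.card_insert_of_notMem hc]
    have := hL.card_pos
    omega
  | join u v h₁ h₂ hd hu hv ih₁ ih₂ =>
    rw [Finset.card_union_of_disjoint hd]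
    omega

theorem disjoint_edges {S₁ S₂ : Finset V} {E₁ E₂ : Finset (Sym2 V)} (h₁ : IsStarTree S₁ E₁)
    (h₂ : IsStarTree S₂ E₂) (hd : Disjoint S₁ S₂) : Disjoint E₁ E₂ := by
  rw [Finset.disjoint_left] at hd ⊢
  intro e he₁ he₂
  induction e with
  | _ a b =>
    exact hd (h₁.mem_of_mem he₁ (Sym2.mem_mk_left a b)) (h₂.mem_of_mem he₂ (Sym2.mem_mk_left a b))

theorem notMem_union_edges {S₁ S₂ : Finset V} {E₁ E₂ : Finset (Sym2 V)} {u v : V}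
    (h₁ : IsStarTree S₁ E₁) (h₂ : IsStarTree S₂ E₂) (hd : Disjoint S₁ S₂) (hu : u ∈ S₁)
    (hv : v ∈ S₂) : s(u, v) ∉ E₁ ∪ E₂ := by
  rw [Finset.disjoint_left] at hd
  rw [Finset.mem_union]
  rintro (h | h)
  · exact hd (h₁.mem_of_mem h (Sym2.mem_mk_right u v)) hv
  · exact hd hu (h₂.mem_of_mem h (Sym2.mem_mk_left u v))

theorem card_edges (h : IsStarTree S E) : E.card + 1 = S.card := by
  induction h with
  | star c L hc hL =>
    rw [Finset.card_insert_of_notMem hc, Finset.card_image_of_injective]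
    exact fun _ _ => Sym2.congr_right.1
  | join u v h₁ h₂ hd hu hv ih₁ ih₂ =>
    rw [Finset.card_union_of_disjoint hd,
      Finset.card_insert_of_notMem (notMem_union_edges h₁ h₂ hd hu hv),
      Finset.card_union_of_disjoint (disjoint_edges h₁ h₂ hd)]
    omega

theorem insert_leaf (h : IsStarTree S E) {a b : V} (ha : a ∈ S) (hb : b ∉ S) :
    IsStarTree (insert b S) (insert s(a, b) E) := by
  induction h with
  | star c L hc hL =>
    have hbc : b ≠ c := fun h => hb (by simp [h])
    have hbL : b ∉ L := fun h => hb (by simp [h])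
    by_cases hac : a = c
    · subst hac
      convert IsStarTree.star a (insert b L) (by simp [hbc.symm, hc]) (by simp) using 1
      · rw [Finset.insert_comm]
      · rw [Finset.image_insert]
    have haL : a ∈ L := by simpa [hac] using ha
    have hab : a ≠ b := fun h => hbL (h ▸ haL)
    by_cases hL1 : L = {a}
    · subst hL1
      convert IsStarTree.star a {c, b} (by simp [hac, hab]) (by simp) using 1
      · ext; simp; tauto
      · rw [Finset.image_insert, Finset.image_singleton, Finset.image_singleton, Sym2.eq_swap,
          Finset.pair_comm, Sym2.eq_swap (a := a) (b := c), Sym2.eq_swap (a := b) (b := a)]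
    · have hne : (L.erase a).Nonempty := by
        rw [Finset.erase_nonempty haL]
        exact (Finset.nontrivial_iff_ne_singleton haL).2 hL1
      convert IsStarTree.join c a (IsStarTree.star c (L.erase a) (by simp [hc]) hne)
        (IsStarTree.star a {b} (by simpa using hab) (by simp)) ?_ (by simp) (by simp) using 1
      · ext i
        simp only [Finset.mem_insert, Finset.mem_union, Finset.mem_erase, Finset.mem_singleton]
        by_cases hi : i = a
        · subst hi; simp [haL]
        · tauto
      · rw [← Finset.insert_erase haL]
        ext e
        simp only [Finset.image_insert, Finset.mem_insert, Finset.mem_union,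
          Finset.image_singleton, Finset.mem_singleton, Finset.erase_insert_eq_erase,
          Finset.erase_idem]
        tauto
      · rw [Finset.disjoint_left]
        intro i
        simp only [Finset.mem_insert, Finset.mem_erase, Finset.mem_singleton]
        rintro (rfl | ⟨h1, h2⟩) (h | h)
        · exact hac h.symm
        · exact hbc h.symm
        · exact h1 h
        · exact hbL (h ▸ h2)
  | @join S₁ S₂ E₁ E₂ u v h₁ h₂ hd hu hv ih₁ ih₂ =>
    rw [Finset.mem_union, not_or] at hb
    rcases Finset.mem_union.1 ha with ha | ha
    · convert IsStarTree.join u v (ih₁ ha hb.1) h₂ ?_ (by simp [hu]) hv using 1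
      · rw [Finset.insert_union]
      · rw [Finset.insert_union, Finset.insert_comm]
      · rw [Finset.disjoint_insert_left]; exact ⟨hb.2, hd⟩
    · convert IsStarTree.join u v h₁ (ih₂ ha hb.2) ?_ hu (by simp [hv]) using 1
      · rw [Finset.union_insert]
      · rw [Finset.union_insert, Finset.insert_comm]
      · rw [Finset.disjoint_insert_right]; exact ⟨hb.1, hd⟩

end IsStarTree

theorem SimpleGraph.Connected.exists_isStarTree {V : Type*} [Fintype V] [DecidableEq V]
    [Nontrivial V] {G : SimpleGraph V} (hG : G.Connected) :
    ∃ E : Finset (Sym2 V), (E : Set (Sym2 V)) ⊆ G.edgeSet ∧ IsStarTree Finset.univ E := by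
  have key : ∀ m : ℕ, m + 2 ≤ Fintype.card V → ∃ (S : Finset V) (E : Finset (Sym2 V)),
      S.card = m + 2 ∧ (E : Set (Sym2 V)) ⊆ G.edgeSet ∧ IsStarTree S E := by
    intro m
    induction m with
    | zero =>
      intro _
      obtain ⟨a⟩ := hG.nonempty
      obtain ⟨b, hab⟩ := hG.preconnected.exists_adj_of_nontrivial a
      refine ⟨_, _, ?_, ?_, IsStarTree.star a {b} (by simpa using hab.ne) (by simp)⟩
      · rw [zero_add]; exact Finset.card_pair hab.ne
      · simpa using hab
    | succ m ih =>
      intro hm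
      obtain ⟨S, E, hS, hE, h⟩ := ih (by omega)
      obtain ⟨a₀, ha₀⟩ : S.Nonempty := Finset.card_pos.1 (by omega)
      obtain ⟨b₀, hb₀⟩ : ∃ b, b ∉ S := by
        by_contra! hc
        have := Finset.card_eq_iff_eq_univ S |>.2 (Finset.eq_univ_of_forall hc)
        omega
      obtain ⟨p⟩ := hG.preconnected a₀ b₀
      obtain ⟨d, -, hd1, hd2⟩ := p.exists_boundary_dart (S : Set V) ha₀ hb₀
      refine ⟨_, _, ?_, ?_, h.insert_leaf hd1 hd2⟩
      · rw [Finset.card_insert_of_notMem hd2]; omega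
      · rw [Finset.coe_insert]
        exact Set.insert_subset d.adj hE
  have hV : 2 ≤ Fintype.card V := Fintype.one_lt_card
  obtain ⟨S, E, hS, hE, h⟩ := key (Fintype.card V - 2) (by omega)
  have : S = Finset.univ := (Finset.card_eq_iff_eq_univ S).1 (by omega)
  exact ⟨E, hE, this ▸ h⟩

/-- A positive semidefinite matrix `Z` of trace at most `#S - x` dominating `Q - x I + x b bᵀ`,
where `Q` is the signless Laplacian of the graph with vertex set `S` and edge set `E`, and `b` is
a unit vector with constant absolute value on `S`. -/
def HasShiftBound {V : Type*} [Fintype V] [DecidableEq V] (x : ℝ) (S : Finset V)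
    (E : Finset (Sym2 V)) : Prop :=
  ∃ (ε : V → ℝ) (Z : Matrix V V ℝ), (∀ i, ε i ^ 2 = 1) ∧ Z.PosSemidef ∧
    Z.trace ≤ S.card - x ∧ ∀ y : V → ℝ,
      ∑ e ∈ E, (edgeVec e ⬝ᵥ y) ^ 2 - x * ∑ i ∈ S, y i ^ 2
        + x * (∑ i ∈ S, ε i * y i) ^ 2 / S.card ≤ y ⬝ᵥ (Z *ᵥ y)

theorem hasShiftBound_star {V : Type*} [Fintype V] [DecidableEq V] {x : ℝ} (hx1 : 1 ≤ x)
    (hx2 : x ≤ 2) {c : V} {L : Finset V} (hc : c ∉ L) (hL : L.Nonempty) :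
    HasShiftBound x (insert c L) (L.image fun l => s(c, l)) := by
  have hLpos : (0 : ℝ) < L.card := by exact_mod_cast hL.card_pos
  have hL1 : (1 : ℝ) ≤ L.card := by exact_mod_cast hL.card_pos
  have hcard : ((insert c L).card : ℝ) = L.card + 1 := by
    rw [Finset.card_insert_of_notMem hc]; push_cast; rfl
  have hne : ∀ l ∈ L, l ≠ c := fun l hl h => hc (h ▸ hl)
  set m : ℝ := (L.card : ℝ) with hm
  set z : V → ℝ := fun i => if i = c then m else if i ∈ L then 1 else 0 with hz
  have hzc : z c = m := by simp [hz]
  have hzL : ∀ l ∈ L, z l = 1 := fun l hl => by simp [hz, hne l hl, hl]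
  have hz0 : ∀ i ∉ insert c L, z i = 0 := by
    intro i hi
    rw [Finset.mem_insert, not_or] at hi
    simp [hz, hi.1, hi.2]
  have hzdot : ∀ y : V → ℝ, z ⬝ᵥ y = m * y c + ∑ l ∈ L, y l := by
    intro y
    rw [dotProduct, ← Finset.sum_subset (Finset.subset_univ (insert c L))
      fun i _ hi => by rw [hz0 i hi, zero_mul], Finset.sum_insert hc, hzc]
    congr 1
    exact Finset.sum_congr rfl fun l hl => by rw [hzL l hl, one_mul]
  have hcoef : 0 ≤ (m + 1 - x) / ((m + 1) * m) := div_nonneg (by linarith) (by positivity)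
  refine ⟨fun i => if i = c then 1 else -1, ((m + 1 - x) / ((m + 1) * m)) • vecMulVec z z,
    ?_, (posSemidef_vecMulVec_self_real z).smul hcoef, ?_, ?_⟩
  · intro i
    by_cases h : i = c <;> simp [h]
  · rw [trace_smul, trace_vecMulVec, hzdot, hzc, Finset.sum_congr rfl hzL, hcard, smul_eq_mul]
    simp only [Finset.sum_const, nsmul_eq_mul, mul_one, ← hm]
    apply le_of_eq
    field_simp
  · intro y
    rw [smul_mulVec, dotProduct_smul, dotProduct_vecMulVec_self_mulVec, hzdot, smul_eq_mul, hcard,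
      Finset.sum_insert hc, Finset.sum_insert hc,
      Finset.sum_image fun _ _ _ _ => Sym2.congr_right.1]
    have h1 : ∑ l ∈ L, (edgeVec s(c, l) ⬝ᵥ y) ^ 2
        = m * y c ^ 2 + 2 * y c * ∑ l ∈ L, y l + ∑ l ∈ L, y l ^ 2 := by
      rw [Finset.sum_congr rfl fun l hl => by
        rw [edgeVec_mk_dotProduct (hne l hl).symm, add_sq]]
      rw [Finset.sum_add_distrib, Finset.sum_add_distrib, ← Finset.mul_sum]
      simp [hm]
    have h2 : ∑ l ∈ L, (if l = c then 1 else -1) * y l = - ∑ l ∈ L, y l := by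
      rw [← Finset.sum_neg_distrib]
      exact Finset.sum_congr rfl fun l hl => by simp [hne l hl]
    have h3 : (∑ l ∈ L, y l) ^ 2 ≤ m * ∑ l ∈ L, y l ^ 2 := sq_sum_le_card_mul_sum_sq
    rw [h1, h2]
    simp only [if_true, one_mul]
    generalize ∑ l ∈ L, y l = s at *
    generalize ∑ l ∈ L, y l ^ 2 = q at *
    have key : (m + 1 - x) / ((m + 1) * m) * (m * y c + s) ^ 2
        - (m * y c ^ 2 + 2 * y c * s + q - x * (y c ^ 2 + q) + x * (y c + -s) ^ 2 / (m + 1))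
        = (x - 1) * (m * q - s ^ 2) / m := by
      field_simp
      ring
    have : 0 ≤ (x - 1) * (m * q - s ^ 2) / m :=
      div_nonneg (mul_nonneg (by linarith) (by linarith)) hLpos.le
    linarith

theorem hasShiftBound_join {V : Type*} [Fintype V] [DecidableEq V] {x : ℝ} {S₁ S₂ : Finset V}
    {E₁ E₂ : Finset (Sym2 V)} {u v : V} (hx : 2 - x ≤ 2 / ((S₁ ∪ S₂).card : ℝ))
    (h₁ : HasShiftBound x S₁ E₁) (h₂ : HasShiftBound x S₂ E₂) (hd : Disjoint S₁ S₂)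
    (hu : u ∈ S₁) (hv : v ∈ S₂) (hE : Disjoint E₁ E₂) (huv : s(u, v) ∉ E₁ ∪ E₂)
    (hc₁ : 2 ≤ S₁.card) (hc₂ : 2 ≤ S₂.card) :
    HasShiftBound x (S₁ ∪ S₂) (insert s(u, v) (E₁ ∪ E₂)) := by
  obtain ⟨ε₁, Z₁, hε₁, hZ₁, ht₁, hb₁⟩ := h₁
  obtain ⟨ε₂, Z₂, hε₂, hZ₂, ht₂, hb₂⟩ := h₂
  have hne : u ≠ v := fun h => Finset.disjoint_left.1 hd hu (h ▸ hv)
  have hd' : ∀ i ∈ S₂, i ∉ S₁ := fun i h2 h1 => Finset.disjoint_left.1 hd h1 h2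
  have hcard : ((S₁ ∪ S₂).card : ℝ) = S₁.card + S₂.card := by
    rw [Finset.card_union_of_disjoint hd]; push_cast; rfl
  have hn₁ : (2 : ℝ) ≤ S₁.card := by exact_mod_cast hc₁
  have hn₂ : (2 : ℝ) ≤ S₂.card := by exact_mod_cast hc₂
  rw [hcard] at hx
  unfold HasShiftBound
  simp only [hcard]
  set n₁ : ℝ := (S₁.card : ℝ) with hn₁'
  set n₂ : ℝ := (S₂.card : ℝ) with hn₂'
  set a := ε₁ u with ha
  set b := ε₂ v with hb
  have ha2 : a ^ 2 = 1 := hε₁ u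
  have hb2 : b ^ 2 = 1 := hε₂ v
  set w : V → ℝ := edgeVec s(u, v) with hw
  set g : V → ℝ := fun i => if i ∈ S₁ then a * ε₁ i / n₁ else if i ∈ S₂ then b * ε₂ i / n₂ else 0
    with hg
  have hg₁ : ∀ i ∈ S₁, g i = a * ε₁ i / n₁ := fun i hi => by simp [hg, hi]
  have hg₂ : ∀ i ∈ S₂, g i = b * ε₂ i / n₂ := fun i hi => by simp [hg, hi, hd' i hi]
  have hg0 : ∀ i ∉ S₁ ∪ S₂, g i = 0 := by
    intro i hi
    rw [Finset.mem_union, not_or] at hi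
    simp [hg, hi.1, hi.2]
  have hgdot : ∀ y : V → ℝ, g ⬝ᵥ y
      = a * (∑ i ∈ S₁, ε₁ i * y i) / n₁ + b * (∑ i ∈ S₂, ε₂ i * y i) / n₂ := by
    intro y
    rw [dotProduct, ← Finset.sum_subset (Finset.subset_univ (S₁ ∪ S₂))
      fun i _ hi => by rw [hg0 i hi, zero_mul], Finset.sum_union hd, Finset.mul_sum,
      Finset.mul_sum, Finset.sum_div, Finset.sum_div]
    congr 1
    · exact Finset.sum_congr rfl fun i hi => by rw [hg₁ i hi]; ring
    · exact Finset.sum_congr rfl fun i hi => by rw [hg₂ i hi]; ring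
  set η : ℝ := 1 / n₁ + 1 / n₂ with hη
  have hη0 : 0 < η := by positivity
  have hη1 : η ≤ 1 := by
    have e1 : 1 / n₁ ≤ 1 / 2 := one_div_le_one_div_of_le (by norm_num) hn₁
    have e2 : 1 / n₂ ≤ 1 / 2 := one_div_le_one_div_of_le (by norm_num) hn₂
    rw [hη]; linarith
  have hηx : 2 - x ≤ η / 2 := by
    refine hx.trans ?_
    rw [hη, div_add_div _ _ (by positivity) (by positivity), div_div,
      div_le_div_iff₀ (by positivity) (by positivity)]
    nlinarith [sq_nonneg (n₁ - n₂)]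
  have hww : w ⬝ᵥ w = 2 := edgeVec_dotProduct_self (by simpa using hne)
  have hwy : ∀ y, w ⬝ᵥ y = y u + y v := edgeVec_mk_dotProduct hne
  have hwg : w ⬝ᵥ g = η := by
    rw [hwy, hg₁ u hu, hg₂ v hv, ← ha, ← hb, ← sq, ← sq, ha2, hb2]
  have hgg : g ⬝ᵥ g = η := by
    rw [hgdot]
    have e1 : ∑ i ∈ S₁, ε₁ i * g i = a := by
      rw [Finset.sum_congr rfl fun i hi => by
        rw [hg₁ i hi, show ε₁ i * (a * ε₁ i / n₁) = a / n₁ * ε₁ i ^ 2 by ring, hε₁, mul_one]]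
      rw [Finset.sum_const, nsmul_eq_mul, ← hn₁']
      field_simp
    have e2 : ∑ i ∈ S₂, ε₂ i * g i = b := by
      rw [Finset.sum_congr rfl fun i hi => by
        rw [hg₂ i hi, show ε₂ i * (b * ε₂ i / n₂) = b / n₂ * ε₂ i ^ 2 by ring, hε₂, mul_one]]
      rw [Finset.sum_const, nsmul_eq_mul, ← hn₂']
      field_simp
    rw [e1, e2, ← sq, ← sq, ha2, hb2]
  have hden : 0 < 4 * x - η := by linarith
  set t : ℝ := 4 * x / (4 * x - η) with ht
  have ht0 : 0 ≤ t := div_nonneg (by linarith) hden.le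
  set p : V → ℝ := w - (1 / 2 : ℝ) • g with hp
  have hpp : t * (p ⬝ᵥ p) ≤ x := by
    have : p ⬝ᵥ p = 2 - 3 / 4 * η := by
      rw [hp]
      simp only [sub_dotProduct, dotProduct_sub, smul_dotProduct, dotProduct_smul, smul_eq_mul,
        dotProduct_comm g w, hww, hwg, hgg]
      ring
    rw [this, ht, div_mul_eq_mul_div, div_le_iff₀ hden]
    have hx0 : 0 ≤ x := by linarith
    nlinarith
  refine ⟨fun i => if i ∈ S₁ then ε₁ i else -(a * b) * ε₂ i, Z₁ + Z₂ + t • vecMulVec p p, ?_,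
    (hZ₁.add hZ₂).add ((posSemidef_vecMulVec_self_real p).smul ht0), ?_, ?_⟩
  · intro i
    by_cases h : i ∈ S₁
    · simp [h, hε₁]
    · simp [h, mul_pow, ha2, hb2, hε₂]
  · rw [trace_add, trace_add, trace_smul, trace_vecMulVec, smul_eq_mul]
    linarith
  · intro y
    have hy₁ := hb₁ y
    have hy₂ := hb₂ y
    have hpy : p ⬝ᵥ y = w ⬝ᵥ y - 1 / 2 * (g ⬝ᵥ y) := by
      simp [hp, sub_dotProduct, smul_dotProduct]
    have hs : ∑ i ∈ S₁ ∪ S₂, (if i ∈ S₁ then ε₁ i else -(a * b) * ε₂ i) * y i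
        = ∑ i ∈ S₁, ε₁ i * y i - a * b * ∑ i ∈ S₂, ε₂ i * y i := by
      rw [Finset.sum_union hd, sub_eq_add_neg, Finset.mul_sum, ← Finset.sum_neg_distrib]
      congr 1
      · exact Finset.sum_congr rfl fun i hi => by simp [hi]
      · exact Finset.sum_congr rfl fun i hi => by rw [if_neg (hd' i hi)]; ring
    rw [Finset.sum_insert huv, Finset.sum_union hE, Finset.sum_union hd, hs, add_mulVec,
      add_mulVec, dotProduct_add, dotProduct_add, smul_mulVec, dotProduct_smul,
      dotProduct_vecMulVec_self_mulVec, hpy, smul_eq_mul, ← hw]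
    have hG := hgdot y
    generalize ∑ i ∈ S₁, ε₁ i * y i = s₁ at *
    generalize ∑ i ∈ S₂, ε₂ i * y i = s₂ at *
    generalize w ⬝ᵥ y = W at *
    generalize g ⬝ᵥ y = γ at *
    have e1 : s₁ ^ 2 / n₁ + s₂ ^ 2 / n₂ - (s₁ - a * b * s₂) ^ 2 / (n₁ + n₂) = γ ^ 2 / η := by
      have e2 : s₁ ^ 2 = a ^ 2 * s₁ ^ 2 := by rw [ha2, one_mul]
      have e3 : s₂ ^ 2 = b ^ 2 * s₂ ^ 2 := by rw [hb2, one_mul]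
      have e4 : (s₁ - a * b * s₂) ^ 2 = (a * s₁ - b * s₂) ^ 2 := by
        linear_combination (s₂ ^ 2 * b ^ 2 - s₁ ^ 2) * ha2
      rw [e4, e2, e3, hG, hη]
      field_simp
      ring
    have e5 : t * (W - 1 / 2 * γ) ^ 2 - W ^ 2 + x * (γ ^ 2 / η)
        = (η * W - 2 * x * γ) ^ 2 / (η * (4 * x - η)) := by
      rw [ht]
      field_simp
      ring
    have e6 : 0 ≤ (η * W - 2 * x * γ) ^ 2 / (η * (4 * x - η)) :=
      div_nonneg (sq_nonneg _) (mul_pos hη0 hden).le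
    rw [← e1] at e5
    simp only [mul_div_assoc] at hy₁ hy₂ ⊢
    linarith

theorem IsStarTree.hasShiftBound {V : Type*} [Fintype V] [DecidableEq V] {S : Finset V}
    {E : Finset (Sym2 V)} (h : IsStarTree S E) {x : ℝ} (hx : 2 - x ≤ 2 / (S.card : ℝ))
    (hx2 : x ≤ 2) : HasShiftBound x S E := by
  induction h with
  | star c L hc hL =>
    refine hasShiftBound_star ?_ hx2 hc hL
    have h2 : (2 : ℝ) ≤ ((insert c L).card : ℝ) := by
      exact_mod_cast (IsStarTree.star c L hc hL).two_le_card
    have : 2 / ((insert c L).card : ℝ) ≤ 1 := (div_le_one (by linarith)).2 h2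
    linarith
  | @join S₁ S₂ E₁ E₂ u v h₁ h₂ hd hu hv ih₁ ih₂ =>
    have p₁ : (0 : ℝ) < S₁.card := by exact_mod_cast Finset.card_pos.2 ⟨u, hu⟩
    have p₂ : (0 : ℝ) < S₂.card := by exact_mod_cast Finset.card_pos.2 ⟨v, hv⟩
    have l₁ : (S₁.card : ℝ) ≤ (S₁ ∪ S₂).card := by
      exact_mod_cast Finset.card_le_card Finset.subset_union_left
    have l₂ : (S₂.card : ℝ) ≤ (S₁ ∪ S₂).card := by
      exact_mod_cast Finset.card_le_card Finset.subset_union_right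
    exact hasShiftBound_join hx (ih₁ (hx.trans (by gcongr))) (ih₂ (hx.trans (by gcongr))) hd hu hv
      (disjoint_edges h₁ h₂ hd) (notMem_union_edges h₁ h₂ hd hu hv) h₁.two_le_card h₂.two_le_card

theorem SimpleGraph.Connected.exists_signlessLap_le {V : Type*} [Fintype V] [DecidableEq V]
    [Nontrivial V] {G : SimpleGraph V} (hG : G.Connected) {x : ℝ} (hx0 : 0 ≤ x)
    (hx : 2 - x ≤ 2 / (Fintype.card V : ℝ)) (hx2 : x ≤ 2) :
    ∃ Z : Matrix V V ℝ, Z.PosSemidef ∧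
      Z.trace ≤ 2 * (numEdges G : ℝ) - Fintype.card V + 2 - x ∧
      ∀ y : V → ℝ, y ⬝ᵥ (signlessLap G *ᵥ y) ≤ x * (y ⬝ᵥ y) + y ⬝ᵥ (Z *ᵥ y) := by
  classical
  obtain ⟨E, hE, hT⟩ := hG.exists_isStarTree
  obtain ⟨ε, Z, -, hZ, htr, hb⟩ := hT.hasShiftBound (by simpa using hx) hx2
  have hEG : E ⊆ G.edgeFinset := fun e he => SimpleGraph.mem_edgeFinset.2 (hE he)
  have hnum : numEdges G = G.edgeFinset.card := by
    rw [numEdges, ← SimpleGraph.coe_edgeFinset, Set.ncard_coe_finset]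
  have hcE : (E.card : ℝ) + 1 = Fintype.card V := by
    exact_mod_cast hT.card_edges
  have hcG : ((G.edgeFinset \ E).card : ℝ) = numEdges G - E.card := by
    rw [Finset.card_sdiff_of_subset hEG, Nat.cast_sub (Finset.card_le_card hEG), hnum]
  refine ⟨Z + ∑ e ∈ G.edgeFinset \ E, vecMulVec (edgeVec e) (edgeVec e),
    hZ.add (posSemidef_sum _ fun e _ => posSemidef_vecMulVec_self_real _), ?_, ?_⟩
  · have h2 : ∀ e ∈ G.edgeFinset \ E, (vecMulVec (edgeVec e) (edgeVec e)).trace = (2 : ℝ) := by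
      intro e he
      rw [trace_vecMulVec]
      exact edgeVec_dotProduct_self (G.not_isDiag_of_mem_edgeFinset (Finset.mem_sdiff.1 he).1)
    rw [trace_add, trace_sum, Finset.sum_congr rfl h2, Finset.sum_const, nsmul_eq_mul, hcG]
    rw [Finset.card_univ] at htr
    linarith
  · intro y
    have hy := hb y
    have h3 : 0 ≤ x * (∑ i, ε i * y i) ^ 2 / (Finset.univ : Finset V).card := by positivity
    have h4 : y ⬝ᵥ y = ∑ i, y i ^ 2 := by simp [dotProduct, sq]
    have h5 : y ⬝ᵥ ((∑ e ∈ G.edgeFinset \ E, vecMulVec (edgeVec e) (edgeVec e)) *ᵥ y)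
        = ∑ e ∈ G.edgeFinset \ E, (edgeVec e ⬝ᵥ y) ^ 2 := by
      rw [sum_mulVec, dotProduct_sum]
      exact Finset.sum_congr rfl fun e _ => dotProduct_vecMulVec_self_mulVec _ _
    rw [dotProduct_signlessLap_mulVec, ← Finset.sum_sdiff hEG, add_mulVec, dotProduct_add, h4, h5]
    linarith

/-- For a connected graph `G` with `n` vertices and any `1 ≤ k ≤ n`,
`S⁺_k(G) ≤ 2e(G) + 2k − n − (2k−2)/n`. -/
theorem splus_le_of_connected {n : ℕ} (G : SimpleGraph (Fin n)) (hG : G.Connected)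
    (k : ℕ) (hk1 : 1 ≤ k) (hkn : k ≤ n) :
    Splus G k ≤ 2 * (numEdges G : ℝ) + 2 * k - n - (2 * (k : ℝ) - 2) / n := by
  have hk : (1 : ℝ) ≤ k := by exact_mod_cast hk1
  rcases Nat.lt_or_ge n 2 with hn | hn
  · obtain rfl : n = 1 := by omega
    obtain rfl : k = 1 := by omega
    have h0 : signlessLap G = 0 := by
      obtain rfl : G = ⊥ := Subsingleton.elim _ _
      ext i j
      simp [signlessLap, SimpleGraph.degMatrix]
    have := sumKLargest_eigenvalues_le (signlessLap_isHermitian G) PosSemidef.zero le_rfl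
      (by simp [h0]) 1
    have hE : (0 : ℝ) ≤ numEdges G := Nat.cast_nonneg _
    rw [trace_zero] at this
    unfold Splus
    norm_num at this ⊢
    linarith
  · have hn' : (2 : ℝ) ≤ n := by exact_mod_cast hn
    have : Nontrivial (Fin n) := Fin.nontrivial_iff_two_le.2 hn
    have hn1 : 2 / (n : ℝ) ≤ 1 := (div_le_one (by linarith)).2 hn'
    have hn0 : 0 ≤ 2 / (n : ℝ) := by positivity
    obtain ⟨Z, hZ, htr, hb⟩ := hG.exists_signlessLap_le (x := 2 - 2 / (n : ℝ)) (by linarith)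
      (by simp) (by linarith)
    refine (sumKLargest_eigenvalues_le (signlessLap_isHermitian G) hZ (by linarith) hb k).trans ?_
    rw [Fintype.card_fin] at htr
    have e : (2 * (k : ℝ) - 2) / n = (k - 1) * (2 / n) := by ring
    rw [e]
    linarith
end

section
/- Let G be a unicyclic graph with n vertices. Then for any 1 ≤ k ≤ n, S⁺_k(G) ≤ e(G) + k(k+1)/2. -/
open Matrix Polynomial

/-- The pairs among `x`, `y`, `z` can be split into six weights, two for each coordinate, each sum
of two opposite weights dominating `1` minus twice the product of the two coordinates. -/
def HasWeights (x y z : ℝ) : Prop :=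
  ∃ a b c d e f : ℝ,
    a ^ 2 + b ^ 2 ≤ 2 * (1 - x ^ 2) ∧ c ^ 2 + d ^ 2 ≤ 2 * (1 - y ^ 2) ∧
    e ^ 2 + f ^ 2 ≤ 2 * (1 - z ^ 2) ∧ 0 ≤ 1 - 2 * x * y ∧ 0 ≤ 1 - 2 * x * z ∧ 0 ≤ 1 - 2 * y * z ∧
    1 - 2 * x * y ≤ a + c ∧ 1 - 2 * x * z ≤ b + e ∧ 1 - 2 * y * z ≤ d + f

namespace HasWeights

theorem swap {x y z : ℝ} (h : HasWeights x y z) : HasWeights y x z := by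
  obtain ⟨a, b, c, d, e, f, h1, h2, h3, h4, h5, h6, h7, h8, h9⟩ := h
  exact ⟨c, d, a, b, f, e, h2, h1, by linarith, by linarith, h6, h5, by linarith, h9, h8⟩

theorem rotate {x y z : ℝ} (h : HasWeights x y z) : HasWeights y z x := by
  obtain ⟨a, b, c, d, e, f, h1, h2, h3, h4, h5, h6, h7, h8, h9⟩ := h
  exact ⟨d, c, f, e, a, b, by linarith, by linarith, by linarith, h6, by linarith, by linarith,
    h9, by linarith, by linarith⟩

theorem neg {x y z : ℝ} (h : HasWeights (-x) (-y) (-z)) : HasWeights x y z := by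
  simpa [HasWeights] using h

theorem of_nonneg {x y z : ℝ} (h : x ^ 2 + y ^ 2 + z ^ 2 = 1) (hx : 0 ≤ x) (hy : 0 ≤ y)
    (hz : 0 ≤ z) : HasWeights x y z := by
  have hxy := mul_nonneg hx hy
  have hxz := mul_nonneg hx hz
  have hyz := mul_nonneg hy hz
  refine ⟨1 - x ^ 2, 1 - x ^ 2, 1 - y ^ 2, 1 - y ^ 2, 1 - z ^ 2, 1 - z ^ 2, ?_, ?_, ?_, ?_, ?_, ?_,
    ?_, ?_, ?_⟩
  · nlinarith [sq_nonneg x, sq_nonneg y, sq_nonneg z]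
  · nlinarith [sq_nonneg x, sq_nonneg y, sq_nonneg z]
  · nlinarith [sq_nonneg x, sq_nonneg y, sq_nonneg z]
  · nlinarith [sq_nonneg (x - y), sq_nonneg z]
  · nlinarith [sq_nonneg (x - z), sq_nonneg y]
  · nlinarith [sq_nonneg (y - z), sq_nonneg x]
  · nlinarith [sq_nonneg z]
  · nlinarith [sq_nonneg y]
  · nlinarith [sq_nonneg x]

theorem of_small {x y z : ℝ} (h : x ^ 2 + y ^ 2 + z ^ 2 = 1) (hy : 0 ≤ y) (hyx : y ≤ x)
    (hz : 0 ≤ z) (hx : x ≤ 41 / 100) : HasWeights x y (-z) := by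
  have hx0 : 0 ≤ x := hy.trans hyx
  have hxy := mul_nonneg hx0 hy
  have key : ∀ t : ℝ, 0 ≤ t → t ≤ 41 / 100 → t ^ 2 + z ^ 2 ≤ 1 →
      (1 / 2) ^ 2 + (1 + 2 * t * z - 7 / 5 * t) ^ 2 ≤ 2 * (1 - t ^ 2) := by
    intro t ht0 ht htz
    have hz' : z ≤ (18281 / 10000 - t ^ 2) / (182 / 100) := by
      rw [le_div_iff₀ (by norm_num)]
      nlinarith [sq_nonneg (z - 91 / 100)]
    have h1 : 1 + 2 * t * z - 7 / 5 * t ≤ 1155 / 1000 + 55 / 1000 * t := by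
      have h2 := mul_le_mul_of_nonneg_left hz' ht0
      have h3 := mul_nonneg (by linarith : 0 ≤ t + 82 / 100) (sq_nonneg (t - 41 / 100))
      nlinarith
    have h0 : 0 ≤ 1 + 2 * t * z - 7 / 5 * t := by nlinarith [mul_nonneg ht0 hz]
    have h2 := pow_le_pow_left₀ h0 h1 2
    nlinarith [mul_nonneg ht0 (sub_nonneg.2 ht)]
  refine ⟨1 / 2, 1 + 2 * x * z - 7 / 5 * x, 1 / 2, 1 + 2 * y * z - 7 / 5 * y, 7 / 5 * x, 7 / 5 * y,
    key x hx0 hx (by nlinarith), key y hy (hyx.trans hx) (by nlinarith), ?_, ?_, ?_, ?_, ?_, ?_, ?_⟩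
  · nlinarith [sq_nonneg x, sq_nonneg y]
  · nlinarith [sq_nonneg (x - y), sq_nonneg z]
  · nlinarith [mul_nonneg hx0 hz]
  · nlinarith [mul_nonneg hy hz]
  · nlinarith
  · linarith
  · linarith

theorem of_large {x y z : ℝ} (h : x ^ 2 + y ^ 2 + z ^ 2 = 1) (hy : 0 ≤ y) (hyx : y ≤ x)
    (hz : 0 ≤ z) (hx : 41 / 100 ≤ x) : HasWeights x y (-z) := by
  have hx0 : 0 ≤ x := hy.trans hyx
  have hxy := mul_nonneg hx0 hy
  have hxz := mul_nonneg hx0 hz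
  have hyz := mul_nonneg hy hz
  have h2xz : 2 * x * z + y ^ 2 ≤ 1 := by nlinarith [sq_nonneg (x - z)]
  have key : 0 ≤ x + 7 / 10 - z - 199 / 100 * y + y ^ 3 + 7 / 5 * y * z := by
    rcases le_total (5 / 7) y with hy7 | hy7
    · have h1 : 0 ≤ (7 / 5 * y - 1) * z := mul_nonneg (by linarith) hz
      nlinarith [mul_nonneg (by linarith : 0 ≤ y + 4 / 5) (sq_nonneg (y - 4 / 7))]
    have hy1 : 0 ≤ 1 - 7 / 5 * y := by linarith
    suffices hs : z * (1 - 7 / 5 * y) ≤ x + 7 / 10 - 199 / 100 * y + y ^ 3 by linarith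
    rcases le_total y (41 / 100) with hy4 | hy4
    · have hz' : z ≤ (8319 / 10000 - y ^ 2 + 7225 / 10000) / (17 / 10) := by
        rw [le_div_iff₀ (by norm_num)]
        nlinarith [sq_nonneg (z - 85 / 100)]
      have h2 := mul_le_mul_of_nonneg_right hz' hy1
      have h3 := sub_nonneg.2 hy4
      nlinarith [mul_nonneg hy h3, mul_nonneg hy (mul_nonneg hy h3), sq_nonneg (y - 1 / 4),
        mul_nonneg hy (sq_nonneg (y - 1 / 4))]
    · have hz' : z ≤ (1 - 2 * y ^ 2 + 64 / 100) / (16 / 10) := by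
        rw [le_div_iff₀ (by norm_num)]
        nlinarith [sq_nonneg (z - 8 / 10)]
      have h2 := mul_le_mul_of_nonneg_right hz' hy1
      have h3 := sub_nonneg.2 hy4
      nlinarith [mul_nonneg h3 hy1, mul_nonneg h3 (mul_nonneg h3 hy1),
        mul_nonneg h3 (sq_nonneg (y - 1 / 2)), sq_nonneg (y - 1 / 2)]
  refine ⟨0, z * (x + z) + y ^ 2, 1 - 2 * x * y, 1 + 2 * y * z - 7 / 5 * y, x * (x + z), 7 / 5 * y,
    ?_, ?_, ?_, ?_, ?_, ?_, ?_, ?_, ?_⟩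
  · have h1 : z ^ 2 * (x + z) ^ 2 ≤ z ^ 2 * (2 - 2 * y ^ 2) :=
      mul_le_mul_of_nonneg_left (by nlinarith [sq_nonneg (x - z)]) (sq_nonneg z)
    have h2 := mul_le_mul_of_nonneg_left h2xz (sq_nonneg y)
    nlinarith
  · nlinarith [mul_nonneg hy key]
  · have h1 : x ^ 2 * (x + z) ^ 2 ≤ x ^ 2 * (2 - 2 * y ^ 2) :=
      mul_le_mul_of_nonneg_left (by nlinarith [sq_nonneg (x - z)]) (sq_nonneg x)
    nlinarith [sq_nonneg (x * y), sq_nonneg y]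
  · nlinarith [sq_nonneg (x - y), sq_nonneg z]
  · nlinarith
  · nlinarith
  · linarith
  · nlinarith
  · nlinarith

theorem of_sum_sq_eq_one {x y z : ℝ} (h : x ^ 2 + y ^ 2 + z ^ 2 = 1) : HasWeights x y z := by
  have odd : ∀ {x y z : ℝ}, x ^ 2 + y ^ 2 + z ^ 2 = 1 → 0 ≤ x → 0 ≤ y → HasWeights x y z := by
    intro x y z h hx hy
    rcases le_total 0 z with hz | hz
    · exact of_nonneg h hx hy hz
    · have main : ∀ {x y : ℝ}, x ^ 2 + y ^ 2 + z ^ 2 = 1 → 0 ≤ y → y ≤ x → HasWeights x y z := by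
        intro x y h hy hyx
        have h' : x ^ 2 + y ^ 2 + (-z) ^ 2 = 1 := by linarith [neg_sq z]
        rw [← neg_neg z]
        rcases le_total x (41 / 100) with hx | hx
        · exact of_small h' hy hyx (neg_nonneg.2 hz) hx
        · exact of_large h' hy hyx (neg_nonneg.2 hz) hx
      rcases le_total y x with hyx | hyx
      · exact main h hy hyx
      · exact (main (by linarith) hx hyx).swap
  have key : ∀ {x y z : ℝ}, x ^ 2 + y ^ 2 + z ^ 2 = 1 → 0 ≤ x → HasWeights x y z := by
    intro x y z h hx
    rcases le_total 0 y with hy | hy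
    · exact odd h hx hy
    · rcases le_total 0 z with hz | hz
      · exact (odd (x := z) (y := x) (z := y) (by linarith) hz hx).rotate
      · refine neg (odd (x := -y) (y := -z) (z := -x) ?_ ?_ ?_).rotate.rotate <;>
          linarith [neg_sq x, neg_sq y, neg_sq z]
  rcases le_total 0 x with hx | hx
  · exact key h hx
  · exact neg (key (by linarith [neg_sq x, neg_sq y, neg_sq z]) (neg_nonneg.2 hx))

end HasWeights

namespace IsStarProjection

variable {V : Type*} [Fintype V] {P : Matrix V V ℝ}

theorem matrix_apply_comm (hP : IsStarProjection P) (u v : V) : P u v = P v u := by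
  have h := congrFun (congrFun hP.isSelfAdjoint.star_eq v) u
  simpa [Matrix.star_eq_conjTranspose] using h

theorem sum_sq_apply (hP : IsStarProjection P) (v : V) : ∑ u, P u v ^ 2 = P v v := by
  conv_rhs => rw [← hP.isIdempotentElem.eq]
  rw [Matrix.mul_apply]
  exact Finset.sum_congr rfl fun u _ => by rw [hP.matrix_apply_comm v u, sq]

theorem diag_nonneg (hP : IsStarProjection P) (v : V) : 0 ≤ P v v := by
  rw [← hP.sum_sq_apply]
  exact Finset.sum_nonneg fun _ _ => sq_nonneg _

theorem two_mul_apply_le (hP : IsStarProjection P) (u v : V) : 2 * P u v ≤ P u u + P v v := by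
  have h : ∑ w, (P w u - P w v) ^ 2 = P u u + P v v - 2 * P u v := by
    have h1 : ∑ w, P w u * P w v = P u v := by
      conv_rhs => rw [← hP.isIdempotentElem.eq]
      rw [Matrix.mul_apply]
      exact Finset.sum_congr rfl fun w _ => by rw [hP.matrix_apply_comm u w]
    rw [← hP.sum_sq_apply u, ← hP.sum_sq_apply v, ← h1, Finset.mul_sum, ← Finset.sum_add_distrib,
      ← Finset.sum_sub_distrib]
    exact Finset.sum_congr rfl fun w _ => by ring
  have := Finset.sum_nonneg fun w (_ : w ∈ Finset.univ) => sq_nonneg (P w u - P w v)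
  linarith

variable [DecidableEq V]

theorem sum_sq_le (hP : IsStarProjection P) {v : V} {s : Finset V} (hv : v ∉ s) :
    ∑ u ∈ s, P u v ^ 2 ≤ P v v * (1 - P v v) := by
  have h := Finset.sum_le_sum_of_subset_of_nonneg (Finset.subset_univ (insert v s))
    fun u _ _ => sq_nonneg (P u v)
  rw [Finset.sum_insert hv, hP.sum_sq_apply] at h
  linarith

theorem diag_le_one (hP : IsStarProjection P) (v : V) : P v v ≤ 1 := by
  have h := hP.sum_sq_le (Finset.notMem_empty v)
  rw [Finset.sum_empty] at h
  nlinarith [hP.diag_nonneg v]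

theorem sq_apply_le (hP : IsStarProjection P) {u v : V} (huv : u ≠ v) :
    P u v ^ 2 ≤ P v v * (1 - P v v) := by
  simpa using hP.sum_sq_le (s := {u}) (by simpa using huv.symm)

end IsStarProjection

/-- The normalised square of an entry of an orthogonal projection. -/
noncomputable def normSqEntry {V : Type*} (P : Matrix V V ℝ) (u v : V) : ℝ :=
  P u v ^ 2 / (1 - P v v)

/-- The sum over `u` of the quadratic form of `P` at the signless edge vector `e_u + e_(f u)`. -/
noncomputable def edgeSum {V : Type*} [Fintype V] (P : Matrix V V ℝ) (f : V → V) : ℝ :=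
  ∑ u, (P u u + P (f u) (f u) + 2 * P u (f u))

theorem edgeSum_eq {V : Type*} [Fintype V] (P : Matrix V V ℝ) (f : V → V) :
    edgeSum P f = P.trace + Fintype.card V + ∑ u, (2 * P u (f u) - (1 - P (f u) (f u))) := by
  have h : (Fintype.card V : ℝ) = ∑ _u : V, (1 : ℝ) := by simp
  rw [edgeSum, Matrix.trace, h, ← Finset.sum_add_distrib, ← Finset.sum_add_distrib]
  exact Finset.sum_congr rfl fun u _ => by rw [Matrix.diag_apply]; ring

namespace IsStarProjection

variable {V : Type*} [Fintype V] [DecidableEq V] {P : Matrix V V ℝ}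

theorem normSqEntry_nonneg (hP : IsStarProjection P) (u v : V) : 0 ≤ normSqEntry P u v :=
  div_nonneg (sq_nonneg _) (sub_nonneg.2 (hP.diag_le_one v))

theorem abs_mul_le (hP : IsStarProjection P) {u v : V} (huv : u ≠ v) (r : ℝ) :
    2 * r * |P u v| ≤ r ^ 2 * (1 - P v v) + normSqEntry P u v := by
  rcases (sub_nonneg.2 (hP.diag_le_one v)).eq_or_lt with h | h
  · have h1 := hP.sq_apply_le huv
    rw [← h, mul_zero] at h1
    have h2 : P u v = 0 := pow_eq_zero_iff two_ne_zero |>.1 (le_antisymm h1 (sq_nonneg _))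
    simp [normSqEntry, ← h, h2]
  · have h1 : normSqEntry P u v * (1 - P v v) = |P u v| ^ 2 := by
      rw [normSqEntry, div_mul_cancel₀ _ h.ne', sq_abs]
    have h2 := sq_nonneg (r * (1 - P v v) - |P u v|)
    nlinarith

theorem mul_apply_le (hP : IsStarProjection P) {u v : V} (huv : u ≠ v) {r : ℝ} (hr : 0 ≤ r) :
    2 * r * P u v ≤ r ^ 2 * (1 - P v v) + normSqEntry P u v :=
  (mul_le_mul_of_nonneg_left (le_abs_self _) (by positivity)).trans (hP.abs_mul_le huv r)

theorem sq_le_normSqEntry (hP : IsStarProjection P) {u v : V} (huv : u ≠ v) :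
    P u v ^ 2 ≤ normSqEntry P u v := by
  have h := hP.abs_mul_le huv |P u v|
  rw [sq_abs] at h
  have h1 : 2 * |P u v| * |P u v| = 2 * P u v ^ 2 := by rw [mul_assoc, abs_mul_abs_self, sq]
  nlinarith [mul_nonneg (sq_nonneg (P u v)) (hP.diag_nonneg v)]

theorem sum_normSqEntry_le (hP : IsStarProjection P) {v : V} {s : Finset V} (hv : v ∉ s) :
    ∑ u ∈ s, normSqEntry P u v ≤ P v v := by
  unfold normSqEntry
  rw [← Finset.sum_div]
  exact div_le_of_le_mul₀ (sub_nonneg.2 (hP.diag_le_one v)) (hP.diag_nonneg v) (hP.sum_sq_le hv)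

theorem edgeSum_le (hP : IsStarProjection P) {f : V → V} (hf : ∀ u, f u ≠ u) :
    edgeSum P f ≤ Fintype.card V + 2 * P.trace := by
  have h1 : ∑ u, (2 * P u (f u) - (1 - P (f u) (f u))) ≤ ∑ u, normSqEntry P u (f u) :=
    Finset.sum_le_sum fun u _ => by
      linarith [hP.mul_apply_le (hf u).symm zero_le_one]
  have h2 : ∑ u, normSqEntry P u (f u) ≤ P.trace := by
    rw [← Finset.sum_fiberwise Finset.univ f]
    refine Finset.sum_le_sum fun v _ => ?_
    refine le_trans (Finset.sum_le_sum fun u hu => ?_)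
      (hP.sum_normSqEntry_le (s := {u | f u = v}) (by simpa using hf v))
    rw [(Finset.mem_filter.1 hu).2]
  rw [edgeSum_eq]
  linarith

/-- A set `s` permuted by `f` improves `IsStarProjection.edgeSum_le` when `f` has no two-cycles. -/
theorem edgeSum_le_of_cycle (hP : IsStarProjection P) {f : V → V} (hf : ∀ u, f u ≠ u)
    (hff : ∀ u, f (f u) ≠ u) {s : Finset V} (hs : Set.BijOn f s s) :
    edgeSum P f ≤ Fintype.card V + 2 * P.trace - (s.card - ∑ u ∈ s, P u u) / 2
      - (∑ u ∈ s, P u u - ∑ u ∈ s, ∑ v ∈ s, P u v ^ 2) := by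
  have hsum : ∀ g : V → ℝ, ∑ u ∈ s, g (f u) = ∑ u ∈ s, g u := fun g =>
    Finset.sum_bij (fun u _ => f u) (fun u hu => hs.mapsTo hu) (fun u hu v hv h => hs.injOn hu hv h)
      (fun v hv => by obtain ⟨u, hu, rfl⟩ := hs.surjOn hv; exact ⟨u, hu, rfl⟩) fun _ _ => rfl
  have h1 : ∑ u, (2 * P u (f u) - (1 - P (f u) (f u))) ≤ ∑ u, (normSqEntry P u (f u) +
      if u ∈ s then normSqEntry P (f u) u + (1 - P u u) / 4 - 3 / 4 * (1 - P (f u) (f u))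
        else 0) := by
    refine Finset.sum_le_sum fun u _ => ?_
    split_ifs
    · have h1 := hP.mul_apply_le (hf u).symm (r := 1 / 2) (by norm_num)
      have h2 := hP.mul_apply_le (hf u) (r := 1 / 2) (by norm_num)
      rw [hP.matrix_apply_comm (f u) u] at h2
      linarith
    · linarith [hP.mul_apply_le (hf u).symm zero_le_one]
  have h1' : ∑ u ∈ s, (normSqEntry P (f u) u + (1 - P u u) / 4 - 3 / 4 * (1 - P (f u) (f u))) =
      ∑ u ∈ s, normSqEntry P (f u) u - (∑ u ∈ s, (1 - P u u)) / 2 := by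
    rw [Finset.sum_sub_distrib, Finset.sum_add_distrib, ← Finset.mul_sum, ← Finset.sum_div,
      hsum fun u => 1 - P u u]
    ring
  rw [Finset.sum_add_distrib, Finset.sum_ite_mem, Finset.univ_inter, h1'] at h1
  have h2 : ∑ u, normSqEntry P u (f u) + ∑ u ∈ s, normSqEntry P (f u) u ≤
      P.trace - ∑ v ∈ sᶜ, ∑ u ∈ s, P u v ^ 2 := by
    have e1 : ∑ u ∈ s, normSqEntry P (f u) u = ∑ v, if v ∈ s then normSqEntry P (f v) v else 0 := by
      rw [Finset.sum_ite_mem, Finset.univ_inter]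
    have e2 : ∑ v ∈ sᶜ, ∑ u ∈ s, P u v ^ 2 = ∑ v, if v ∈ s then 0 else ∑ u ∈ s, P u v ^ 2 := by
      rw [← Finset.sum_add_sum_compl s fun v => if v ∈ s then 0 else ∑ u ∈ s, P u v ^ 2,
        Finset.sum_eq_zero fun v hv => if_pos hv, zero_add]
      exact Finset.sum_congr rfl fun v hv => (if_neg (Finset.mem_compl.1 hv)).symm
    rw [e1, e2, Matrix.trace, ← Finset.sum_sub_distrib, ← Finset.sum_fiberwise Finset.univ f,
      ← Finset.sum_add_distrib]
    refine Finset.sum_le_sum fun v _ => ?_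
    have e3 : ∑ u with f u = v, normSqEntry P u (f u) = ∑ u with f u = v, normSqEntry P u v :=
      Finset.sum_congr rfl fun u hu => by rw [(Finset.mem_filter.1 hu).2]
    rw [e3, Matrix.diag_apply]
    split_ifs with hv
    · have h := hP.sum_normSqEntry_le (v := v)
        (s := insert (f v) (Finset.univ.filter fun u => f u = v))
        (by simpa using ⟨(hf v).symm, hf v⟩)
      rw [Finset.sum_insert (by simpa using hff v)] at h
      linarith
    · have hd : Disjoint (Finset.univ.filter fun u => f u = v) s := by
        rw [Finset.disjoint_left]
        rintro u hu hus
        exact hv ((Finset.mem_filter.1 hu).2 ▸ hs.mapsTo hus)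
      have h := hP.sum_normSqEntry_le (v := v) (s := Finset.univ.filter (fun u => f u = v) ∪ s)
        (by simpa using ⟨hf v, hv⟩)
      rw [Finset.sum_union hd] at h
      have h' : ∑ u ∈ s, P u v ^ 2 ≤ ∑ u ∈ s, normSqEntry P u v :=
        Finset.sum_le_sum fun u hu => hP.sq_le_normSqEntry fun huv => hv (huv ▸ hu)
      linarith
  have h3 : ∑ v ∈ sᶜ, ∑ u ∈ s, P u v ^ 2 = ∑ u ∈ s, P u u - ∑ u ∈ s, ∑ v ∈ s, P u v ^ 2 := by
    have h : ∑ u ∈ s, P u u = ∑ u ∈ s, ∑ v, P v u ^ 2 :=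
      Finset.sum_congr rfl fun u _ => (hP.sum_sq_apply u).symm
    rw [h, Finset.sum_comm, ← Finset.sum_sub_distrib]
    refine Finset.sum_congr rfl fun u _ => ?_
    rw [← Finset.sum_add_sum_compl s fun v => P v u ^ 2]
    simp only [hP.matrix_apply_comm u, add_sub_cancel_left]
  have h4 : ∑ u ∈ s, (1 - P u u) = s.card - ∑ u ∈ s, P u u := by simp
  rw [edgeSum_eq]
  linarith

end IsStarProjection

theorem sq_add_sq_add_two_mul_sq_le {F G H : ℝ} (h1 : H ^ 2 ≤ F * G)
    (h2 : H ^ 2 ≤ (1 - F) * (1 - G)) (h : F + G ≤ 3 / 2) (hF : 0 ≤ F) (hG : 0 ≤ G) :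
    F ^ 2 + G ^ 2 + 2 * H ^ 2 ≤ 1 / 2 + (F + G) / 2 := by
  rcases le_total (F + G) 1 with h3 | h3
  · nlinarith
  · nlinarith

theorem exists_unit_orthogonal (x₁ x₂ x₃ y₁ y₂ y₃ : ℝ) : ∃ a b c : ℝ, a ^ 2 + b ^ 2 + c ^ 2 = 1 ∧
    a * x₁ + b * x₂ + c * x₃ = 0 ∧ a * y₁ + b * y₂ + c * y₃ = 0 := by
  obtain ⟨v, hv, h⟩ := (Matrix.exists_mulVec_eq_zero_iff
    (M := !![x₁, x₂, x₃; y₁, y₂, y₃; 0, 0, 0])).2 (by simp [Matrix.det_fin_three])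
  have h0 := congrFun h 0
  have h1 := congrFun h 1
  simp only [Matrix.mulVec, dotProduct, Fin.sum_univ_three, Matrix.of_apply, Matrix.cons_val_zero,
    Matrix.cons_val_one, Matrix.cons_val, Pi.zero_apply] at h0 h1
  have hpos : 0 < v 0 ^ 2 + v 1 ^ 2 + v 2 ^ 2 := by
    refine lt_of_le_of_ne (by positivity) fun h => hv (funext fun i => ?_)
    fin_cases i <;> simp <;> nlinarith [sq_nonneg (v 0), sq_nonneg (v 1), sq_nonneg (v 2)]
  set r := √(v 0 ^ 2 + v 1 ^ 2 + v 2 ^ 2) with hr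
  have hr2 : r ^ 2 = v 0 ^ 2 + v 1 ^ 2 + v 2 ^ 2 := Real.sq_sqrt hpos.le
  have hr0 : r ≠ 0 := (Real.sqrt_pos.2 hpos).ne'
  refine ⟨v 0 / r, v 1 / r, v 2 / r, ?_, ?_, ?_⟩
  · field_simp
    exact hr2.symm
  · field_simp
    linarith
  · field_simp
    linarith

namespace IsStarProjection

variable {V : Type*} [Fintype V] [DecidableEq V] {P : Matrix V V ℝ} {x y : V → ℝ}

theorem two_mul_sum_triangle_le (hP : IsStarProjection P)
    (hxy : ∀ u v, P u v = x u * x v + y u * y v) {i j k : V} (hij : i ≠ j) (hik : i ≠ k)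
    (hjk : j ≠ k) :
    2 * (P i j + P i k + P j k) ≤ normSqEntry P j i + normSqEntry P k i + normSqEntry P i j +
      normSqEntry P k j + normSqEntry P i k + normSqEntry P j k +
      4 - 2 * (P i i + P j j + P k k) := by
  obtain ⟨α, β, γ, hu, hα, hβ⟩ := exists_unit_orthogonal (x i) (x j) (x k) (y i) (y j) (y k)
  have hzero : P i i * α ^ 2 + P j j * β ^ 2 + P k k * γ ^ 2 + 2 * P i j * (α * β) +
      2 * P i k * (α * γ) + 2 * P j k * (β * γ) = 0 := by
    simp only [hxy]
    linear_combination (α * x i + β * x j + γ * x k) * hα + (α * y i + β * y j + γ * y k) * hβ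
  obtain ⟨a, b, c, d, e, f, h1, h2, h3, h4, h5, h6, h7, h8, h9⟩ := HasWeights.of_sum_sq_eq_one hu
  have pair : ∀ {u v : V} {t r s : ℝ}, u ≠ v → 0 ≤ t → t ≤ r + s → 2 * P u v * t ≤
      r ^ 2 * (1 - P u u) + normSqEntry P v u + (s ^ 2 * (1 - P v v) + normSqEntry P u v) := by
    intro u v t r s huv ht hts
    have e1 := hP.abs_mul_le huv s
    have e2 := hP.abs_mul_le huv.symm r
    rw [hP.matrix_apply_comm v u] at e2
    have e3 := mul_le_mul_of_nonneg_right (le_abs_self (P u v)) ht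
    have e4 := mul_le_mul_of_nonneg_left hts (abs_nonneg (P u v))
    linarith
  have p1 := pair hij h4 h7
  have p2 := pair hik h5 h8
  have p3 := pair hjk h6 h9
  have w1 := mul_le_mul_of_nonneg_right h1 (sub_nonneg.2 (hP.diag_le_one i))
  have w2 := mul_le_mul_of_nonneg_right h2 (sub_nonneg.2 (hP.diag_le_one j))
  have w3 := mul_le_mul_of_nonneg_right h3 (sub_nonneg.2 (hP.diag_le_one k))
  linarith

theorem edgeSum_le_of_light_triangle (hP : IsStarProjection P)
    (hxy : ∀ u v, P u v = x u * x v + y u * y v) (hx : ∑ u, x u ^ 2 = 1) (hy : ∑ u, y u ^ 2 = 1)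
    (ho : ∑ u, x u * y u = 0) {f : V → V} (hf : ∀ u, f u ≠ u) (hff : ∀ u, f (f u) ≠ u)
    {s : Finset V} (hs : Set.BijOn f s s) (hcard : s.card = 3)
    (hlight : ∑ u ∈ s, P u u ≤ 3 / 2) :
    edgeSum P f ≤ Fintype.card V + 3 := by
  have htr : P.trace = 2 := by
    have : P.trace = ∑ u, x u ^ 2 + ∑ u, y u ^ 2 := by
      rw [Matrix.trace, ← Finset.sum_add_distrib]
      exact Finset.sum_congr rfl fun u _ => by rw [Matrix.diag_apply, hxy]; ring
    rw [this, hx, hy]; norm_num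
  have h := hP.edgeSum_le_of_cycle hf hff hs
  rw [htr, hcard] at h
  have hdiag : ∑ u ∈ s, P u u = ∑ u ∈ s, x u ^ 2 + ∑ u ∈ s, y u ^ 2 := by
    rw [← Finset.sum_add_distrib]
    exact Finset.sum_congr rfl fun u _ => by rw [hxy]; ring
  have hsq : ∑ u ∈ s, ∑ v ∈ s, P u v ^ 2 = (∑ u ∈ s, x u ^ 2) ^ 2 + (∑ u ∈ s, y u ^ 2) ^ 2 +
      2 * (∑ u ∈ s, x u * y u) ^ 2 := by
    simp only [sq (∑ u ∈ s, _), Finset.sum_mul_sum]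
    simp only [hxy, Finset.mul_sum, ← Finset.sum_add_distrib]
    exact Finset.sum_congr rfl fun u _ => Finset.sum_congr rfl fun v _ => by ring
  have c1 := Finset.sum_mul_sq_le_sq_mul_sq s x y
  have c2 := Finset.sum_mul_sq_le_sq_mul_sq sᶜ x y
  have d1 := Finset.sum_add_sum_compl s fun u => x u ^ 2
  have d2 := Finset.sum_add_sum_compl s fun u => y u ^ 2
  have d3 := Finset.sum_add_sum_compl s fun u => x u * y u
  rw [show ∑ u ∈ sᶜ, x u ^ 2 = 1 - ∑ u ∈ s, x u ^ 2 by linarith,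
    show ∑ u ∈ sᶜ, y u ^ 2 = 1 - ∑ u ∈ s, y u ^ 2 by linarith,
    show ∑ u ∈ sᶜ, x u * y u = - ∑ u ∈ s, x u * y u by linarith, neg_sq] at c2
  have key := sq_add_sq_add_two_mul_sq_le c1 c2 (hdiag ▸ hlight) (Finset.sum_nonneg fun _ _ => sq_nonneg _)
    (Finset.sum_nonneg fun _ _ => sq_nonneg _)
  rw [← hsq, ← hdiag] at key
  push_cast at h
  linarith

theorem edgeSum_le_of_heavy_triangle (hP : IsStarProjection P)
    (hxy : ∀ u v, P u v = x u * x v + y u * y v) (htr : P.trace = 2) {f : V → V}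
    (hf : ∀ u, f u ≠ u) {i j k : V} (hi : f i = j) (hj : f j = k) (hk : f k = i) (hik : i ≠ k)
    (hheavy : 3 / 2 ≤ P i i + P j j + P k k) :
    edgeSum P f ≤ Fintype.card V + 3 := by
  have hij : i ≠ j := by rw [← hi]; exact (hf i).symm
  have hjk : j ≠ k := by rw [← hj]; exact (hf j).symm
  set s : Finset V := {i, j, k} with hs
  have hsum : ∀ g : V → ℝ, ∑ u ∈ s, g u = g i + g j + g k := fun g => by
    rw [hs, Finset.sum_insert (by simp [hij, hik]), Finset.sum_pair hjk, add_assoc]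
  have hfs : ∀ u ∈ s, f u ∈ s := by
    intro u hu
    rw [hs, Finset.mem_insert, Finset.mem_insert, Finset.mem_singleton] at hu
    rcases hu with rfl | rfl | rfl <;> simp [hs, hi, hj, hk]
  have hout : ∀ u ∉ s, 2 * P u (f u) - (1 - P (f u) (f u)) ≤
      if f u ∈ s then normSqEntry P u (f u) else 0 := by
    intro u hu
    split_ifs with h
    · linarith [hP.mul_apply_le (hf u).symm zero_le_one]
    · have hle := Finset.sum_le_sum_of_subset_of_nonneg
        (Finset.subset_univ (insert u (insert (f u) s))) fun v _ _ => hP.diag_nonneg v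
      have htr' : ∑ v, P v v = 2 := htr
      rw [Finset.sum_insert (by simpa [hu] using (hf u).symm), Finset.sum_insert h, hsum,
        htr'] at hle
      linarith [hP.two_mul_apply_le u (f u), hP.diag_nonneg u]
  have hkids : ∀ v ∈ s, ∑ u ∈ sᶜ with f u = v, normSqEntry P u v +
      ∑ u ∈ s.erase v, normSqEntry P u v ≤ P v v := by
    intro v hv
    rw [← Finset.sum_union]
    · exact hP.sum_normSqEntry_le (by simp [hv])
    · rw [Finset.disjoint_left]
      intro u hu hu'
      simp_all
  have hsec : ∑ u ∈ sᶜ, (2 * P u (f u) - (1 - P (f u) (f u))) ≤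
      ∑ v ∈ s, (P v v - ∑ u ∈ s.erase v, normSqEntry P u v) := by
    calc _ ≤ ∑ u ∈ sᶜ, if f u ∈ s then normSqEntry P u (f u) else 0 :=
          Finset.sum_le_sum fun u hu => hout u (Finset.mem_compl.1 hu)
      _ = ∑ v ∈ s, ∑ u ∈ sᶜ with f u = v, normSqEntry P u v := by
          rw [← Finset.sum_filter, ← Finset.sum_fiberwise_of_maps_to
            (s := sᶜ.filter fun u => f u ∈ s) (t := s) (g := f)
            fun u hu => (Finset.mem_filter.1 hu).2]
          refine Finset.sum_congr rfl fun v hv => ?_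
          rw [Finset.filter_filter]
          refine Finset.sum_congr ?_ fun u hu => by rw [(Finset.mem_filter.1 hu).2]
          exact Finset.filter_congr fun u _ => ⟨fun h => h.2, fun h => ⟨h ▸ hv, h⟩⟩
      _ ≤ _ := Finset.sum_le_sum fun v hv => by linarith [hkids v hv]
  have e1 : s.erase i = {j, k} := by ext u; simp [hs]; grind
  have e2 : s.erase j = {i, k} := by ext u; simp [hs]; grind
  have e3 : s.erase k = {i, j} := by ext u; simp [hs]; grind
  rw [hsum, e1, e2, e3, Finset.sum_pair hjk, Finset.sum_pair hik, Finset.sum_pair hij] at hsec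
  have htri := hP.two_mul_sum_triangle_le hxy hij hik hjk
  rw [edgeSum_eq, htr, ← Finset.sum_add_sum_compl s, hsum, hi, hj, hk, hP.matrix_apply_comm k i]
  linarith

end IsStarProjection

namespace SimpleGraph

variable {V : Type*} [Fintype V] {G : SimpleGraph V}

theorem Connected.not_isAcyclic_of_ncard_edgeSet (hG : G.Connected)
    (he : G.edgeSet.ncard = Fintype.card V) : ¬ G.IsAcyclic := by
  classical
  intro h
  have h1 := (IsTree.mk hG h).card_edgeFinset
  rw [← coe_edgeFinset, Set.ncard_coe_finset] at he
  omega

/-- A connected graph with as many edges as vertices is the graph of a fixed-point free map without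
two-cycles, every orbit of which reaches a common point. -/
theorem Connected.exists_parent_map (hG : G.Connected) (he : G.edgeSet.ncard = Fintype.card V) :
    ∃ (f : V → V) (c : V), (∀ u, f u ≠ u) ∧ (∀ u, f (f u) ≠ u) ∧
      (∀ u v, G.Adj u v ↔ v = f u ∨ u = f v) ∧ ∀ u, ∃ m, f^[m] u = c := by
  classical
  have hac := hG.not_isAcyclic_of_ncard_edgeSet he
  rw [isAcyclic_iff_forall_adj_isBridge] at hac
  push Not at hac
  obtain ⟨c, d, hcd, hbr⟩ := hac
  set T := G.deleteEdges {s(c, d)} with hT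
  have hTc : T.Connected := hG.connected_delete_edge_of_not_isBridge hbr
  have hstep : ∀ u, u ≠ c → ∃ w, T.Adj u w ∧ T.dist u c = T.dist w c + 1 := by
    intro u hu
    obtain ⟨p, hp⟩ := hTc.exists_walk_length_eq_dist u c
    cases p with
    | nil => exact absurd rfl hu
    | @cons _ w _ h p =>
      refine ⟨w, h, le_antisymm ?_ ?_⟩
      · have := hTc.dist_triangle (u := u) (v := w) (w := c)
        rw [dist_eq_one_iff_adj.2 h] at this
        omega
      · rw [Walk.length_cons] at hp
        have := dist_le p
        omega
  choose! g hg hgd using hstep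
  set f : V → V := fun u => if u = c then d else g u with hf
  have hfc : f c = d := if_pos rfl
  have hfg : ∀ {u}, u ≠ c → f u = g u := fun hu => if_neg hu
  have hTG : ∀ {u v}, T.Adj u v → G.Adj u v ∧ s(u, v) ≠ s(c, d) := fun h => by
    simpa [hT, deleteEdges_adj] using h
  have hadj : ∀ u, G.Adj u (f u) := by
    intro u
    by_cases hu : u = c
    · rw [hu, hfc]; exact hcd
    · rw [hfg hu]; exact (hTG (hg u hu)).1
  have hne : ∀ u, f u ≠ u := fun u => (hadj u).ne'
  have hff : ∀ u, f (f u) ≠ u := by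
    intro u h
    by_cases hu : u = c
    · have hd : d ≠ c := hcd.ne'
      rw [hu, hfc, hfg hd] at h
      exact (hTG (hg d hd)).2 (by rw [h, Sym2.eq_swap])
    · rw [hfg hu] at h
      by_cases hgu : g u = c
      · rw [hgu, hfc] at h
        exact (hTG (hg u hu)).2 (by rw [hgu, h, Sym2.eq_swap])
      · have h1 := hgd u hu
        have h2 := hgd (g u) hgu
        rw [hfg hgu] at h
        rw [h] at h2
        omega
  have hinj : Function.Injective fun u => s(u, f u) := by
    intro u v h
    rcases Sym2.eq_iff.1 h with ⟨h1, -⟩ | ⟨h1, h2⟩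
    · exact h1
    · exact absurd (h1 ▸ h2 : f (f v) = v) (hff v)
  have himg : Finset.univ.image (fun u => s(u, f u)) = G.edgeFinset := by
    refine Finset.eq_of_subset_of_card_le ?_ ?_
    · intro e he
      obtain ⟨u, -, rfl⟩ := Finset.mem_image.1 he
      exact mem_edgeFinset.2 (hadj u)
    · rw [Finset.card_image_of_injective _ hinj, Finset.card_univ, ← he, ← coe_edgeFinset,
        Set.ncard_coe_finset]
  refine ⟨f, c, hne, hff, fun u v => ⟨fun h => ?_, ?_⟩, ?_⟩
  · have h' : s(u, v) ∈ G.edgeFinset := mem_edgeFinset.2 h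
    rw [← himg] at h'
    obtain ⟨w, -, hw⟩ := Finset.mem_image.1 h'
    rcases Sym2.eq_iff.1 hw with ⟨rfl, h2⟩ | ⟨rfl, h2⟩
    · exact .inl h2.symm
    · exact .inr h2.symm
  · rintro (rfl | rfl)
    · exact hadj u
    · exact (hadj v).symm
  · intro u
    induction hn : T.dist u c generalizing u with
    | zero => exact ⟨0, (hTc.dist_eq_zero_iff).1 hn⟩
    | succ n ih =>
      have hu : u ≠ c := by rintro rfl; simp at hn
      obtain ⟨m, hm⟩ := ih (f u) (by rw [hfg hu]; have := hgd u hu; omega)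
      exact ⟨m + 1, hm⟩

end SimpleGraph

/-- A map reaching `c` from everywhere permutes the forward orbit of `c`. -/
theorem exists_bijOn_forward_orbit {V : Type*} [Finite V] {f : V → V} {c : V}
    (hc : ∀ u, ∃ m, f^[m] u = c) : ∃ s : Finset V, Set.BijOn f s s ∧ c ∈ s := by
  classical
  have hfin := Set.toFinite (Set.range fun m => f^[m] c)
  have hmaps : Set.MapsTo f (Set.range fun m => f^[m] c) (Set.range fun m => f^[m] c) := by
    rintro _ ⟨m, rfl⟩
    exact ⟨m + 1, Function.iterate_succ_apply' f m c⟩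
  have hsurj : Set.SurjOn f (Set.range fun m => f^[m] c) (Set.range fun m => f^[m] c) := by
    rintro _ ⟨m, rfl⟩
    cases m with
    | zero =>
      obtain ⟨l, hl⟩ := hc (f c)
      exact ⟨f^[l] c, ⟨l, rfl⟩, (Function.iterate_succ_apply' f l c).symm.trans hl⟩
    | succ m => exact ⟨f^[m] c, ⟨m, rfl⟩, (Function.iterate_succ_apply' f m c).symm⟩
  refine ⟨hfin.toFinset, ?_, by simpa using ⟨0, rfl⟩⟩
  rw [hfin.coe_toFinset]
  exact ⟨hmaps, (Set.Finite.surjOn_iff_bijOn_of_mapsTo hfin hmaps).1 hsurj |>.injOn, hsurj⟩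

theorem exists_finset_sumKLargest_eq {V : Type*} [Fintype V] (v : V → ℝ) {k : ℕ}
    (hk : k ≤ Fintype.card V) : ∃ s : Finset V, s.card = k ∧ sumKLargest v k = ∑ i ∈ s, v i := by
  classical
  set l := (Finset.univ.val.map v).toList.mergeSort fun a b => decide (b ≤ a) with hl
  have hperm : l.Perm ((Finset.univ : Finset V).toList.map v) := by
    refine (List.mergeSort_perm _ _).trans ?_
    rw [← Multiset.coe_eq_coe, Multiset.coe_toList, ← Multiset.map_coe, Finset.coe_toList]
  obtain ⟨l₁, h₁, hsub⟩ := List.exists_perm_sublist (l.take_sublist k) hperm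
  obtain ⟨l₂, h₂, rfl⟩ := List.sublist_map_iff.1 hsub
  have hnd : l₂.Nodup := (Finset.nodup_toList _).sublist h₂
  refine ⟨l₂.toFinset, ?_, ?_⟩
  · rw [List.toFinset_card_of_nodup hnd, ← List.length_map v, h₁.length_eq, List.length_take,
      hperm.length_eq, List.length_map, Finset.length_toList, Finset.card_univ, min_eq_left hk]
  · rw [List.sum_toFinset _ hnd, h₁.sum_eq, sumKLargest]

namespace Matrix.IsHermitian

variable {V : Type*} [Fintype V] [DecidableEq V] {A : Matrix V V ℝ}

/-- The orthogonal projection onto the span of the eigenvectors indexed by `s`. -/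
noncomputable def eigenProjection (hA : A.IsHermitian) (s : Finset V) : Matrix V V ℝ :=
  Matrix.of fun u v => ∑ j ∈ s, hA.eigenvectorBasis j u * hA.eigenvectorBasis j v

theorem eigenProjection_apply (hA : A.IsHermitian) (s : Finset V) (u v : V) :
    hA.eigenProjection s u v = ∑ j ∈ s, hA.eigenvectorBasis j u * hA.eigenvectorBasis j v :=
  rfl

theorem sum_eigenvectorBasis_mul (hA : A.IsHermitian) (i j : V) :
    ∑ u, hA.eigenvectorBasis i u * hA.eigenvectorBasis j u = if i = j then 1 else 0 := by
  rw [← orthonormal_iff_ite.1 hA.eigenvectorBasis.orthonormal i j, PiLp.inner_apply]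
  exact Finset.sum_congr rfl fun u _ => by simp [mul_comm]

theorem isStarProjection_eigenProjection (hA : A.IsHermitian) (s : Finset V) :
    IsStarProjection (hA.eigenProjection s) where
  isIdempotentElem := by
    ext u v
    simp only [Matrix.mul_apply, eigenProjection_apply, Finset.sum_mul_sum]
    rw [Finset.sum_comm]
    refine Finset.sum_congr rfl fun i hi => ?_
    rw [Finset.sum_comm]
    have h : ∀ j, ∑ w, hA.eigenvectorBasis i u * hA.eigenvectorBasis i w *
        (hA.eigenvectorBasis j w * hA.eigenvectorBasis j v) =
        if i = j then hA.eigenvectorBasis i u * hA.eigenvectorBasis j v else 0 := by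
      intro j
      have e : ∀ w, hA.eigenvectorBasis i u * hA.eigenvectorBasis i w *
          (hA.eigenvectorBasis j w * hA.eigenvectorBasis j v) =
          hA.eigenvectorBasis i w * hA.eigenvectorBasis j w *
            (hA.eigenvectorBasis i u * hA.eigenvectorBasis j v) := fun w => by ring
      simp only [e]
      rw [← Finset.sum_mul, hA.sum_eigenvectorBasis_mul, ite_mul, one_mul, zero_mul]
    simp only [h]
    rw [Finset.sum_ite_eq, if_pos hi]
  isSelfAdjoint := by
    ext u v
    simp [Matrix.star_apply, eigenProjection_apply, mul_comm]

theorem trace_eigenProjection (hA : A.IsHermitian) (s : Finset V) :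
    (hA.eigenProjection s).trace = s.card := by
  simp only [Matrix.trace, Matrix.diag_apply, eigenProjection_apply]
  rw [Finset.sum_comm]
  simp [hA.sum_eigenvectorBasis_mul]

theorem sum_eigenvalues_eq (hA : A.IsHermitian) (s : Finset V) :
    ∑ j ∈ s, hA.eigenvalues j = ∑ u, ∑ v, A u v * hA.eigenProjection s u v := by
  have h : ∀ j, hA.eigenvalues j =
      ∑ u, ∑ v, A u v * (hA.eigenvectorBasis j u * hA.eigenvectorBasis j v) := by
    intro j
    have h1 : ∀ u, ∑ v, A u v * hA.eigenvectorBasis j v =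
        hA.eigenvalues j * hA.eigenvectorBasis j u := fun u => by
      simpa [Matrix.mulVec, dotProduct] using congrFun (hA.mulVec_eigenvectorBasis j) u
    have h2 : ∀ u, ∑ v, A u v * (hA.eigenvectorBasis j u * hA.eigenvectorBasis j v) =
        hA.eigenvalues j * (hA.eigenvectorBasis j u * hA.eigenvectorBasis j u) := fun u => by
      rw [mul_left_comm, ← h1 u, Finset.mul_sum]
      exact Finset.sum_congr rfl fun v _ => by ring
    rw [Finset.sum_congr rfl fun u _ => h2 u, ← Finset.mul_sum, hA.sum_eigenvectorBasis_mul,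
      if_pos rfl, mul_one]
  rw [Finset.sum_congr rfl fun j _ => h j, Finset.sum_comm]
  refine Finset.sum_congr rfl fun u _ => ?_
  rw [Finset.sum_comm]
  exact Finset.sum_congr rfl fun v _ => by rw [eigenProjection_apply, Finset.mul_sum]

end Matrix.IsHermitian

theorem sum_signlessLap_mul_eq_edgeSum {V : Type*} [Fintype V] [DecidableEq V] {G : SimpleGraph V}
    {P : Matrix V V ℝ} (hP : IsStarProjection P) {f : V → V} (hff : ∀ u, f (f u) ≠ u)
    (hadj : ∀ u v, G.Adj u v ↔ v = f u ∨ u = f v) :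
    ∑ u, ∑ v, signlessLap G u v * P u v = edgeSum P f := by
  classical
  have hentry : ∀ u v, (if G.Adj u v then (1 : ℝ) else 0) =
      (if v = f u then 1 else 0) + if u = f v then 1 else 0 := by
    intro u v
    by_cases h1 : v = f u <;> by_cases h2 : u = f v
    · exact absurd (h1 ▸ h2).symm (hff u)
    · simp [hadj, h1, h1 ▸ h2]
    · simp [hadj, h1, ← h2]
    · simp [hadj, h1, h2]
  have hdeg : ∀ u, (G.degree u : ℝ) = ∑ v, if G.Adj u v then 1 else 0 := fun u => by
    simp [← SimpleGraph.card_neighborFinset_eq_degree, SimpleGraph.neighborFinset_eq_filter]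
  have h1 : ∀ u, ∑ v, signlessLap G u v * P u v =
      ∑ v, (if G.Adj u v then (1 : ℝ) else 0) * (P u u + P u v) := by
    intro u
    have h2 : ∀ v, signlessLap G u v * P u v = (if u = v then G.degree u * P u v else 0) +
        (if G.Adj u v then (1 : ℝ) else 0) * P u v := by
      intro v
      rcases eq_or_ne u v with rfl | huv
      · simp [signlessLap, SimpleGraph.degMatrix]
      · simp [signlessLap, SimpleGraph.degMatrix, SimpleGraph.adjMatrix_apply, huv]
    simp only [h2, mul_add, Finset.sum_add_distrib, Finset.sum_ite_eq, Finset.mem_univ, if_true,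
      hdeg, Finset.sum_mul]
  simp only [h1, hentry, add_mul, Finset.sum_add_distrib, ite_mul, one_mul, zero_mul,
    Finset.sum_ite_eq', Finset.mem_univ, if_true]
  rw [Finset.sum_comm (f := fun u v => if u = f v then P u u + P u v else 0)]
  simp only [Finset.sum_ite_eq', Finset.mem_univ, if_true, edgeSum, ← Finset.sum_add_distrib]
  exact Finset.sum_congr rfl fun u _ => by rw [hP.matrix_apply_comm (f u) u]; ring

theorem IsStarProjection.edgeSum_le_of_long_cycle {V : Type*} [Fintype V] [DecidableEq V]
    {P : Matrix V V ℝ} (hP : IsStarProjection P) {f : V → V} (hf : ∀ u, f u ≠ u)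
    (hff : ∀ u, f (f u) ≠ u) {s : Finset V} (hs : Set.BijOn f s s)
    (hcard : P.trace + 2 ≤ s.card) :
    edgeSum P f ≤ Fintype.card V + 2 * P.trace - 1 := by
  have h := hP.edgeSum_le_of_cycle hf hff hs
  have h1 : ∑ u ∈ s, P u u ≤ P.trace :=
    Finset.sum_le_sum_of_subset_of_nonneg (Finset.subset_univ s) fun u _ _ => hP.diag_nonneg u
  have h2 : ∑ u ∈ s, ∑ v ∈ s, P u v ^ 2 ≤ ∑ u ∈ s, P u u := by
    refine Finset.sum_le_sum fun u _ => ?_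
    rw [← hP.sum_sq_apply u]
    simp only [hP.matrix_apply_comm u]
    exact Finset.sum_le_sum_of_subset_of_nonneg (Finset.subset_univ s) fun _ _ _ => sq_nonneg _
  linarith

theorem Set.BijOn.eq_orbit_of_card_eq_three {V : Type*} [DecidableEq V] {f : V → V}
    (hf : ∀ u, f u ≠ u) (hff : ∀ u, f (f u) ≠ u) {s : Finset V} (hs : Set.BijOn f s s) {c : V}
    (hc : c ∈ s) (hcard : s.card = 3) : s = {c, f c, f (f c)} ∧ f (f (f c)) = c := by
  have h1 : f c ∈ s := hs.mapsTo hc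
  have h2 : f (f c) ∈ s := hs.mapsTo h1
  have h3 : f (f (f c)) ∈ s := hs.mapsTo h2
  have hsc : ({c, f c, f (f c)} : Finset V) = s := by
    refine Finset.eq_of_subset_of_card_le ?_ ?_
    · simp [Finset.insert_subset_iff, hc, h1, h2]
    · rw [hcard, Finset.card_eq_three.2 ⟨c, f c, f (f c), (hf c).symm, (hff c).symm,
        (hf (f c)).symm, rfl⟩]
  refine ⟨hsc.symm, ?_⟩
  rw [← hsc] at h3
  simpa [hf (f (f c)), hff (f c)] using h3

/-- Conjecture `S⁺_k(G) ≤ e(G) + k(k+1)/2` holds for unicyclic graphs: if `G` is connected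
with `n` vertices and `n` edges, then for any `1 ≤ k ≤ n` the bound holds. -/
theorem splus_le_of_unicyclic {n : ℕ} (G : SimpleGraph (Fin n)) (hG : G.Connected)
    (he : numEdges G = n) (k : ℕ) (hk1 : 1 ≤ k) (hkn : k ≤ n) :
    Splus G k ≤ (numEdges G : ℝ) + k * (k + 1) / 2 := by
  obtain ⟨f, c, hf, hff, hadj, hc⟩ := hG.exists_parent_map (he.trans (Fintype.card_fin n).symm)
  obtain ⟨s, hs, hcs⟩ := exists_bijOn_forward_orbit hc
  have hA := signlessLap_isHermitian G
  obtain ⟨J, hJ, hsum⟩ := exists_finset_sumKLargest_eq hA.eigenvalues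
    (hkn.trans (Fintype.card_fin n).ge)
  have hP := hA.isStarProjection_eigenProjection J
  have htr := hA.trace_eigenProjection J
  have hS : Splus G k = edgeSum (hA.eigenProjection J) f := by
    rw [Splus, hsum, hA.sum_eigenvalues_eq, sum_signlessLap_mul_eq_edgeSum hP hff hadj]
  rw [hS, he]
  rw [hJ] at htr
  have hs3 : 3 ≤ s.card := by
    have hsub : ({c, f c, f (f c)} : Finset (Fin n)) ⊆ s := by
      simpa [Finset.insert_subset_iff] using
        ⟨hcs, hs.mapsTo hcs, hs.mapsTo (hs.mapsTo hcs)⟩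
    rw [← Finset.card_eq_three.2 ⟨c, f c, f (f c), (hf c).symm, (hff c).symm,
        (hf (f c)).symm, rfl⟩]
    exact Finset.card_le_card hsub
  rcases le_or_gt 3 k with hk3 | hk3
  · have h := hP.edgeSum_le hf
    rw [htr, Fintype.card_fin] at h
    have hk3' : (3 : ℝ) ≤ k := by exact_mod_cast hk3
    nlinarith
  rcases le_or_gt (k + 2) s.card with hks | hks
  · have h := hP.edgeSum_le_of_long_cycle hf hff hs (by rw [htr]; exact_mod_cast hks)
    rw [htr, Fintype.card_fin] at h
    interval_cases k <;> norm_num at h ⊢ <;> linarith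
  obtain rfl : k = 2 := by omega
  have hcard : s.card = 3 := by omega
  obtain ⟨i, j, hij, rfl⟩ := Finset.card_eq_two.1 hJ
  have hxy : ∀ u v, hA.eigenProjection {i, j} u v =
      hA.eigenvectorBasis i u * hA.eigenvectorBasis i v +
        hA.eigenvectorBasis j u * hA.eigenvectorBasis j v := fun u v => by
    rw [hA.eigenProjection_apply, Finset.sum_pair hij]
  have hgoal : edgeSum (hA.eigenProjection {i, j}) f ≤ Fintype.card (Fin n) + 3 := by
    obtain ⟨hsc, hfc⟩ := hs.eq_orbit_of_card_eq_three hf hff hcs hcard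
    rcases le_total (∑ u ∈ s, hA.eigenProjection {i, j} u u) (3 / 2) with h | h
    · have hnorm : ∀ i, ∑ u, hA.eigenvectorBasis i u ^ 2 = 1 := fun i => by
        simpa [sq] using hA.sum_eigenvectorBasis_mul i i
      exact hP.edgeSum_le_of_light_triangle hxy (hnorm i) (hnorm j)
        (by simpa [hij] using hA.sum_eigenvectorBasis_mul i j) hf hff hs hcard h
    · rw [hsc, Finset.sum_insert (by simpa using ⟨(hf c).symm, (hff c).symm⟩),
        Finset.sum_pair (hf (f c)).symm, ← add_assoc] at h
      exact hP.edgeSum_le_of_heavy_triangle hxy (by simpa using htr) hf rfl rfl hfc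
        (hff c).symm h
  rw [Fintype.card_fin] at hgoal
  norm_num at hgoal ⊢
  linarith
end

section
/- If for some integer k the inequality S⁺_k(G) ≤ e(G) + k(k+1)/2 holds for graphs G and H, then it also holds for the disjoint union G ∪ H. -/
open Matrix Polynomial

theorem sq_one_sub_mul_le {x y : ℝ} (hx0 : 0 ≤ x) (hx1 : x ≤ 1) (hy0 : 0 ≤ y) (hy1 : y ≤ 1) :
    (1 - x * y) ^ 2 ≤ 3 / 2 * (2 - x - y) - (1 - x) * (1 - y) * (1 + x + y) := by
  have hxy : x * y ≤ 1 := by nlinarith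
  have hpi : 0 ≤ x * y := by positivity
  have hs : 4 * (x * y) ≤ (x + y) ^ 2 := by nlinarith [sq_nonneg (x - y)]
  nlinarith [sq_nonneg (x - y), mul_nonneg (sub_nonneg.2 hx1) (sub_nonneg.2 hy1),
    mul_nonneg hpi (sub_nonneg.2 hxy), sq_nonneg (x + y - 1), sq_nonneg (x * y - x - y + 1),
    mul_nonneg hx0 (sub_nonneg.2 hx1), mul_nonneg hy0 (sub_nonneg.2 hy1),
    mul_nonneg (mul_nonneg (sub_nonneg.2 hx1) (sub_nonneg.2 hy1)) hpi,
    mul_nonneg (mul_nonneg (sub_nonneg.2 hx1) (sub_nonneg.2 hy1)) hx0,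
    mul_nonneg (mul_nonneg (sub_nonneg.2 hx1) (sub_nonneg.2 hy1)) hy0]

/-- The weight given to a vertex whose diagonal entry in a projection is `p`. -/
noncomputable def rowWeight (p : ℝ) : ℝ := 3 / 2 / (1 - p) - 1 - p

theorem one_le_one_add_rowWeight_add {x y : ℝ} (hx0 : 0 ≤ x) (hx1 : x < 1) (hy0 : 0 ≤ y)
    (hy1 : y < 1) : 1 ≤ 1 + rowWeight x + rowWeight y := by
  have key : ∀ p : ℝ, 0 ≤ p → p < 1 → 0 ≤ rowWeight p := by
    intro p h0 h1
    have : 1 + p ≤ 3 / 2 / (1 - p) := by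
      rw [le_div_iff₀ (by linarith)]
      nlinarith
    unfold rowWeight
    linarith
  linarith [key x hx0 hx1, key y hy0 hy1]

theorem sq_one_sub_mul_le_mul_rowWeight {x y : ℝ} (hx0 : 0 ≤ x) (hx1 : x < 1) (hy0 : 0 ≤ y)
    (hy1 : y < 1) :
    (1 - x * y) ^ 2 ≤ (1 - x) * (1 - y) * (1 + rowWeight x + rowWeight y) := by
  have h1 : 1 - x ≠ 0 := by linarith
  have h2 : 1 - y ≠ 0 := by linarith
  have : (1 - x) * (1 - y) * (1 + rowWeight x + rowWeight y) =
      3 / 2 * (2 - x - y) - (1 - x) * (1 - y) * (1 + x + y) := by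
    unfold rowWeight
    field_simp
    ring
  rw [this]
  exact sq_one_sub_mul_le hx0 hx1.le hy0 hy1.le

/-- An upper bound for the contribution of the pair of vertices with diagonal entries `x`, `y` and
off-diagonal entry `z`. -/
noncomputable def pairBound (x y z : ℝ) : ℝ :=
  x * y + 2 * (x * y * z) + (1 + rowWeight x + rowWeight y) * z ^ 2

theorem pairBound_nonneg {x y z : ℝ} (hx0 : 0 ≤ x) (hy0 : 0 ≤ y) (hy1 : y ≤ 1)
    (hzx : z ^ 2 ≤ x * (1 - x)) (hzy : z ^ 2 ≤ y * (1 - y)) : 0 ≤ pairBound x y z := by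
  by_cases hz : z = 0
  · subst hz
    simpa [pairBound] using mul_nonneg hx0 hy0
  have hz2 : 0 < z ^ 2 := by positivity
  have hx : x < 1 := by nlinarith
  have hy : y < 1 := by nlinarith
  have ha := one_le_one_add_rowWeight_add hx0 hx hy0 hy
  unfold pairBound
  set a := 1 + rowWeight x + rowWeight y
  have hxy : x * y ≤ 1 := by nlinarith
  have hxy0 : 0 ≤ x * y := by positivity
  nlinarith [sq_nonneg (z + x * y), mul_nonneg hxy0 (sub_nonneg.2 hxy),
    mul_nonneg (sub_nonneg.2 ha) hz2.le]

theorem le_pairBound {x y z : ℝ} (hx0 : 0 ≤ x) (hx1 : x ≤ 1) (hy0 : 0 ≤ y) (hy1 : y ≤ 1)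
    (hzx : z ^ 2 ≤ x * (1 - x)) (hzy : z ^ 2 ≤ y * (1 - y)) :
    x + y - 1 + 2 * z ≤ pairBound x y z := by
  by_cases hz : z = 0
  · subst hz
    simp only [pairBound]
    nlinarith [mul_nonneg (sub_nonneg.2 hx1) (sub_nonneg.2 hy1)]
  have hz2 : 0 < z ^ 2 := by positivity
  have hx : x < 1 := by nlinarith
  have hy : y < 1 := by nlinarith
  have ha := one_le_one_add_rowWeight_add hx0 hx hy0 hy
  have hk := sq_one_sub_mul_le_mul_rowWeight hx0 hx hy0 hy
  unfold pairBound
  set a := 1 + rowWeight x + rowWeight y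
  have : 0 ≤ a * ((1 - x) * (1 - y) - 2 * (1 - x * y) * z + a * z ^ 2) := by
    nlinarith [sq_nonneg (a * z - (1 - x * y))]
  have := nonneg_of_mul_nonneg_right this (by linarith)
  linarith

theorem rowWeight_mul_le (p : ℝ) :
    rowWeight p * (p * (1 - p)) ≤ 3 / 2 * p - p * (1 - p) - p ^ 2 * (1 - p) := by
  unfold rowWeight
  by_cases h : 1 - p = 0
  · simp only [h]; nlinarith
  · apply le_of_eq
    field_simp

section Projection

variable {V : Type*} [Fintype V] {P : Matrix V V ℝ}

theorem sum_sq_apply_of_isSymm_of_mul_self (hs : P.IsSymm) (hp : P * P = P) (x : V) :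
    ∑ y, P x y ^ 2 = P x x := by
  conv_rhs => rw [← hp, Matrix.mul_apply]
  exact Finset.sum_congr rfl fun y _ => by rw [hs.apply x y, sq]

theorem sq_apply_le_mul_one_sub (hs : P.IsSymm) (hp : P * P = P) {x y : V} (hxy : x ≠ y) :
    P x y ^ 2 ≤ P x x * (1 - P x x) := by
  classical
  have h : P x x ^ 2 + P x y ^ 2 ≤ P x x := by
    refine le_of_le_of_eq ?_ (sum_sq_apply_of_isSymm_of_mul_self hs hp x)
    rw [← Finset.sum_pair (f := fun y => P x y ^ 2) hxy]
    exact Finset.sum_le_univ_sum_of_nonneg fun y => sq_nonneg _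
  linarith

theorem apply_self_nonneg_of_mul_self (hs : P.IsSymm) (hp : P * P = P) (x : V) : 0 ≤ P x x := by
  rw [← sum_sq_apply_of_isSymm_of_mul_self hs hp x]
  exact Finset.sum_nonneg fun y _ => sq_nonneg _

theorem apply_self_le_one_of_mul_self (hs : P.IsSymm) (hp : P * P = P) (x : V) : P x x ≤ 1 := by
  have h : P x x ^ 2 ≤ P x x :=
    (Finset.single_le_sum (f := fun y => P x y ^ 2) (fun y _ => sq_nonneg _)
      (Finset.mem_univ x)).trans_eq (sum_sq_apply_of_isSymm_of_mul_self hs hp x)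
  nlinarith [apply_self_nonneg_of_mul_self hs hp x]

theorem dotProduct_mulVec_le_of_mul_self (hs : P.IsSymm) (hp : P * P = P) (v : V → ℝ) :
    v ⬝ᵥ P *ᵥ v ≤ v ⬝ᵥ v := by
  have h : v ⬝ᵥ P *ᵥ v = P *ᵥ v ⬝ᵥ P *ᵥ v := by
    conv_lhs => rw [← hp, ← mulVec_mulVec, dotProduct_mulVec, ← mulVec_transpose, hs.eq]
  have h0 : 0 ≤ (v - P *ᵥ v) ⬝ᵥ (v - P *ᵥ v) := Finset.sum_nonneg fun y _ => mul_self_nonneg _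
  rw [sub_dotProduct, dotProduct_sub, dotProduct_sub, dotProduct_comm (P *ᵥ v) v] at h0
  linarith

theorem sum_sum_pairBound_sub_le (hs : P.IsSymm) (hp : P * P = P) :
    ∑ x, ∑ y, pairBound (P x x) (P y y) (P x y) - ∑ x, pairBound (P x x) (P x x) (P x x) ≤
      P.trace ^ 2 + 2 * P.trace := by
  have hrow := sum_sq_apply_of_isSymm_of_mul_self hs hp
  have hquad : ∑ x, ∑ y, P x x * P y y * P x y ≤ ∑ x, P x x ^ 2 := by
    have h := dotProduct_mulVec_le_of_mul_self hs hp P.diag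
    simp only [mulVec, dotProduct, diag_apply, Finset.mul_sum] at h
    simp only [sq, mul_assoc, mul_comm (P _ _) (P _ _)] at h ⊢
    exact h
  have hw : ∑ x, ∑ y, rowWeight (P y y) * P x y ^ 2 = ∑ x, rowWeight (P x x) * P x x := by
    rw [Finset.sum_comm]
    refine Finset.sum_congr rfl fun y _ => ?_
    rw [← Finset.mul_sum, ← hrow y]
    simp only [hs.apply]
  have ht : ∑ x, ∑ y, P x x * P y y = P.trace ^ 2 := by
    simp only [← Finset.mul_sum, ← Finset.sum_mul, trace, diag_apply, sq]
  have hx : ∑ x, ∑ y, (1 + rowWeight (P x x)) * P x y ^ 2 =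
      ∑ x, (1 + rowWeight (P x x)) * P x x := by
    simp only [← Finset.mul_sum, hrow]
  have hsum : ∑ x, ∑ y, pairBound (P x x) (P y y) (P x y) =
      P.trace ^ 2 + 2 * ∑ x, ∑ y, P x x * P y y * P x y +
        ∑ x, (1 + rowWeight (P x x)) * P x x + ∑ x, rowWeight (P x x) * P x x := by
    rw [← ht, ← hx, ← hw]
    simp only [Finset.mul_sum, ← Finset.sum_add_distrib]
    refine Finset.sum_congr rfl fun x _ => Finset.sum_congr rfl fun y _ => ?_
    unfold pairBound
    ring
  have hvert : ∑ x, (2 * P x x ^ 2 + (1 + rowWeight (P x x)) * P x x +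
      rowWeight (P x x) * P x x - pairBound (P x x) (P x x) (P x x)) ≤ ∑ x, 2 * P x x := by
    refine Finset.sum_le_sum fun x _ => ?_
    have := rowWeight_mul_le (P x x)
    unfold pairBound
    linarith
  simp only [Finset.sum_sub_distrib, Finset.sum_add_distrib, ← Finset.mul_sum] at hvert
  simp only [trace, diag_apply] at hsum ⊢
  simp only [Finset.sum_add_distrib, add_mul] at hsum hvert ⊢
  linarith

theorem two_mul_trace_mul_signlessLap_le [DecidableEq V] (G : SimpleGraph V) (hs : P.IsSymm)
    (hp : P * P = P) :
    2 * (P * signlessLap G).trace ≤ 2 * (numEdges G : ℝ) + P.trace ^ 2 + 2 * P.trace := by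
  classical
  set a : V → V → ℝ := fun x y => if G.Adj x y then 1 else 0 with ha
  have hasymm : ∀ x y, a x y = a y x := fun x y => by simp [ha, G.adj_comm]
  have hdeg : ∀ x, (G.degree x : ℝ) = ∑ y, a x y := fun x => by
    simp [ha, ← G.card_neighborFinset_eq_degree, SimpleGraph.neighborFinset_eq_filter]
  have he : 2 * (numEdges G : ℝ) = ∑ x, ∑ y, a x y := by
    have h := G.sum_degrees_eq_twice_card_edges
    have hn : numEdges G = G.edgeFinset.card := by
      rw [numEdges, Set.ncard_eq_toFinset_card', SimpleGraph.edgeFinset]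
    rw [hn]
    simp only [← hdeg]
    exact_mod_cast h.symm
  have htr : (P * signlessLap G).trace = ∑ x, ∑ y, a x y * P x x + ∑ x, ∑ y, a x y * P x y := by
    rw [signlessLap, mul_add, trace_add]
    congr 1
    · simp only [trace, diag_apply, SimpleGraph.degMatrix, mul_diagonal, ← Finset.sum_mul]
      refine Finset.sum_congr rfl fun x _ => ?_
      rw [← hdeg, mul_comm]
    · simp only [trace, diag_apply, mul_apply, SimpleGraph.adjMatrix_apply]
      refine Finset.sum_congr rfl fun x _ => Finset.sum_congr rfl fun y _ => ?_
      simp [ha, G.adj_comm]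
  have hswap : ∑ x, ∑ y, a x y * P y y = ∑ x, ∑ y, a x y * P x x := by
    rw [Finset.sum_comm]
    simp only [hasymm]
  have hpair : ∀ x y, a x y * (P x x + P y y - 1 + 2 * P x y) ≤
      pairBound (P x x) (P y y) (P x y) -
        if x = y then pairBound (P x x) (P x x) (P x x) else 0 := by
    intro x y
    by_cases hxy : x = y
    · subst hxy
      simp [ha]
    have hx0 := apply_self_nonneg_of_mul_self hs hp x
    have hy0 := apply_self_nonneg_of_mul_self hs hp y
    have hx1 := apply_self_le_one_of_mul_self hs hp x
    have hy1 := apply_self_le_one_of_mul_self hs hp y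
    have hzx := sq_apply_le_mul_one_sub hs hp hxy
    have hzy := sq_apply_le_mul_one_sub hs hp (Ne.symm hxy)
    rw [hs.apply] at hzy
    by_cases hadj : G.Adj x y
    · simpa [ha, hadj, hxy] using le_pairBound hx0 hx1 hy0 hy1 hzx hzy
    · simpa [ha, hadj, hxy] using pairBound_nonneg hx0 hy0 hy1 hzx hzy
  have hle := Finset.sum_le_sum fun x (_ : x ∈ Finset.univ) =>
    Finset.sum_le_sum fun y (_ : y ∈ Finset.univ) => hpair x y
  have hexp : ∑ x, ∑ y, a x y * (P x x + P y y - 1 + 2 * P x y) =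
      ∑ x, ∑ y, a x y * P x x + ∑ x, ∑ y, a x y * P y y - ∑ x, ∑ y, a x y +
        2 * ∑ x, ∑ y, a x y * P x y := by
    simp only [Finset.mul_sum, ← Finset.sum_add_distrib, ← Finset.sum_sub_distrib]
    exact Finset.sum_congr rfl fun x _ => Finset.sum_congr rfl fun y _ => by ring
  simp only [Finset.sum_sub_distrib, Finset.sum_ite_eq, Finset.mem_univ, if_true] at hle
  have := sum_sum_pairBound_sub_le hs hp
  rw [hexp] at hle
  rw [htr, he]
  linarith

end Projection

section Spectrum

variable {V : Type*} [Fintype V] [DecidableEq V]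

theorem sum_eigenvalues_signlessLap_le (G : SimpleGraph V) (S : Finset V) :
    ∑ i ∈ S, (signlessLap_isHermitian G).eigenvalues i ≤
      (numEdges G : ℝ) + S.card * (S.card + 2) / 2 := by
  set hA := signlessLap_isHermitian G
  set U : Matrix V V ℝ := hA.eigenvectorUnitary.1
  set d : V → ℝ := fun i => if i ∈ S then 1 else 0 with hd
  have hUU : star U * U = 1 := mem_unitaryGroup_iff'.1 hA.eigenvectorUnitary.2
  have hspec : signlessLap G = U * diagonal hA.eigenvalues * star U := by
    conv_lhs => rw [hA.spectral_theorem, Unitary.conjStarAlgAut_apply]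
    rfl
  have hsymm : (U * diagonal d * star U).IsSymm := by
    simp [Matrix.IsSymm, star_eq_conjTranspose, transpose_mul, mul_assoc]
  have hmul : ∀ f g : V → ℝ, U * diagonal f * star U * (U * diagonal g * star U) =
      U * diagonal (fun i => f i * g i) * star U := by
    intro f g
    rw [← diagonal_mul_diagonal]
    calc _ = U * diagonal f * (star U * U) * (diagonal g * star U) := by simp only [mul_assoc]
      _ = _ := by rw [hUU]; simp only [mul_assoc, mul_one]
  have htrace : ∀ f : V → ℝ, (U * diagonal f * star U).trace = ∑ i, f i := by
    intro f
    rw [trace_mul_comm, ← mul_assoc, hUU, one_mul, trace_diagonal]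
  have hproj : U * diagonal d * star U * (U * diagonal d * star U) = U * diagonal d * star U := by
    rw [hmul]
    simp [hd, ← ite_and]
  have h := two_mul_trace_mul_signlessLap_le G hsymm hproj
  rw [htrace, hspec, hmul, htrace] at h
  simp only [hd, ite_mul, one_mul, zero_mul, Finset.sum_ite_mem, Finset.univ_inter,
    Finset.sum_const, nsmul_eq_mul, mul_one] at h
  linarith

theorem eigenvalues_signlessLap_nonneg (G : SimpleGraph V) (i : V) :
    0 ≤ (signlessLap_isHermitian G).eigenvalues i := by
  classical
  have h : signlessLap G = G.incMatrix ℝ * (G.incMatrix ℝ)ᴴ := by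
    rw [conjTranspose_eq_transpose_of_trivial, SimpleGraph.incMatrix_mul_transpose]
    ext x y
    by_cases hxy : x = y
    · subst hxy
      simp [signlessLap, SimpleGraph.degMatrix]
    · simp [signlessLap, SimpleGraph.degMatrix, hxy, SimpleGraph.adjMatrix_apply]
  have hpos : (signlessLap G).PosSemidef := h ▸ posSemidef_self_mul_conjTranspose _
  exact hpos.eigenvalues_nonneg i

/-- The multiset of signless Laplacian eigenvalues. -/
noncomputable def signlessSpectrum (G : SimpleGraph V) : Multiset ℝ :=
  Finset.univ.val.map (signlessLap_isHermitian G).eigenvalues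

theorem roots_charpoly_signlessLap (G : SimpleGraph V) :
    (signlessLap G).charpoly.roots = signlessSpectrum G :=
  (signlessLap_isHermitian G).roots_charpoly_eq_eigenvalues

theorem signlessSpectrum_sum {W : Type*} [Fintype W] [DecidableEq W] (G : SimpleGraph V)
    (H : SimpleGraph W) :
    signlessSpectrum (G ⊕g H) = signlessSpectrum G + signlessSpectrum H := by
  classical
  have h : signlessLap (G ⊕g H) = fromBlocks (signlessLap G) 0 0 (signlessLap H) := by
    ext (x | x) (y | y) <;>
      simp [signlessLap, SimpleGraph.degMatrix, diagonal_apply, SimpleGraph.adjMatrix_apply,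
        SimpleGraph.degree_eq_sum_if_adj (R := ℝ),
        Fintype.sum_sum_type, -Finset.sum_boole]
  rw [← roots_charpoly_signlessLap, h, charpoly_fromBlocks_zero₁₂, Polynomial.roots_mul
    (mul_ne_zero (charpoly_monic _).ne_zero (charpoly_monic _).ne_zero),
    roots_charpoly_signlessLap, roots_charpoly_signlessLap]

end Spectrum

theorem numEdges_sum {V W : Type*} [Fintype V] [Fintype W] (G : SimpleGraph V)
    (H : SimpleGraph W) : numEdges (G ⊕g H) = numEdges G + numEdges H := by
  simp only [numEdges, ← Nat.card_coe_set_eq]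
  rw [Nat.card_congr SimpleGraph.edgeSetSumEquiv, Nat.card_sum]

theorem Multiset.exists_finset_map_val_eq_of_le {V α : Type*} [Fintype V] {f : V → α}
    {A : Multiset α} (h : A ≤ Finset.univ.val.map f) : ∃ S : Finset V, S.val.map f = A := by
  have hA := Multiset.mem_powersetCard.2 ⟨h, rfl⟩
  rw [Multiset.powersetCard_map, Multiset.mem_map] at hA
  obtain ⟨s, hs, rfl⟩ := hA
  have hs := (Multiset.mem_powersetCard.1 hs).1
  exact ⟨⟨s, Multiset.nodup_of_le hs Finset.univ.nodup⟩, rfl⟩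

theorem List.sum_le_sum_take_of_pairwise_ge {l : List ℝ} (hl : l.Pairwise (· ≥ ·))
    (h0 : ∀ a ∈ l, 0 ≤ a) {k : ℕ} {B : Multiset ℝ} (hB : B ≤ l) (hk : B.card ≤ k) :
    B.sum ≤ (l.take k).sum := by
  induction l generalizing k B with
  | nil =>
    obtain rfl : B = 0 := by simpa using hB
    simp
  | cons a l ih =>
    rw [List.pairwise_cons] at hl
    obtain rfl | ⟨b, hb⟩ := B.empty_or_exists_mem
    · exact List.sum_nonneg fun x hx => h0 x (List.mem_of_mem_take hx)
    obtain ⟨b, hb, hba, hle⟩ : ∃ b ∈ B, b ≤ a ∧ B.erase b ≤ (l : Multiset ℝ) := by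
      by_cases ha : a ∈ B
      · refine ⟨a, ha, le_rfl, ?_⟩
        simpa using Multiset.erase_le_erase a hB
      · have hBl : B ≤ (l : Multiset ℝ) := by
          rw [← Multiset.cons_coe] at hB
          exact (Multiset.le_cons_of_notMem ha).1 hB
        exact ⟨b, hb, hl.1 b (Multiset.mem_of_le hBl hb), (Multiset.erase_le b B).trans hBl⟩
    obtain ⟨C, rfl⟩ := Multiset.exists_cons_of_mem hb
    rw [Multiset.erase_cons_head] at hle
    rw [Multiset.card_cons] at hk
    obtain ⟨k, rfl⟩ : ∃ m, k = m + 1 := ⟨k - 1, by omega⟩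
    rw [Multiset.sum_cons, List.take_succ_cons, List.sum_cons]
    exact add_le_add hba (ih hl.2 (fun x hx => h0 x (List.mem_cons_of_mem a hx)) hle (by omega))

section SumKLargest

variable {V : Type*} [Fintype V] (v : V → ℝ) (k : ℕ)

theorem exists_le_map_sum_eq_sumKLargest :
    ∃ T ≤ Finset.univ.val.map v, T.card ≤ k ∧ T.sum = sumKLargest v k := by
  set l := (Finset.univ.val.map v).toList.mergeSort (fun a b => decide (b ≤ a))
  have hperm : (l : Multiset ℝ) = Finset.univ.val.map v := by
    rw [Multiset.coe_eq_coe.2 (List.mergeSort_perm _ _), Multiset.coe_toList]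
  exact ⟨(l.take k : List ℝ), hperm ▸ (List.take_sublist k l).subperm, by simp, rfl⟩

variable {v k}

theorem sum_le_sumKLargest (hv : ∀ i, 0 ≤ v i) {B : Multiset ℝ}
    (hB : B ≤ Finset.univ.val.map v) (hk : B.card ≤ k) : B.sum ≤ sumKLargest v k := by
  have hperm := List.mergeSort_perm (Finset.univ.val.map v).toList (fun a b => decide (b ≤ a))
  refine List.sum_le_sum_take_of_pairwise_ge ?_ ?_ ?_ hk
  · simpa using List.pairwise_mergeSort (le := fun a b : ℝ => decide (b ≤ a))
      (fun a b c hab hbc => by simp only [decide_eq_true_eq] at *; exact hbc.trans hab)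
      (fun a b => by simpa using le_total b a) (Finset.univ.val.map v).toList
  · intro a ha
    rw [hperm.mem_iff, Multiset.mem_toList, Multiset.mem_map] at ha
    obtain ⟨i, -, rfl⟩ := ha
    exact hv i
  · rwa [Multiset.coe_eq_coe.2 hperm, Multiset.coe_toList]

end SumKLargest

theorem sum_le_of_le_signlessSpectrum {V : Type*} [Fintype V] [DecidableEq V] {G : SimpleGraph V}
    {A : Multiset ℝ} (hA : A ≤ signlessSpectrum G) :
    A.sum ≤ (numEdges G : ℝ) + A.card * (A.card + 2) / 2 := by
  obtain ⟨S, rfl⟩ := Multiset.exists_finset_map_val_eq_of_le hA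
  simpa using sum_eigenvalues_signlessLap_le G S

/-- If for some integer `k` the inequality `S⁺_k(G) ≤ e(G) + k(k+1)/2` holds for the graphs
`G` and `H`, then it holds for their disjoint union `G ∪ H`. -/
theorem splus_le_sum_graph {V W : Type*} [Fintype V] [DecidableEq V] [Fintype W]
    [DecidableEq W] (G : SimpleGraph V) (H : SimpleGraph W) (k : ℕ)
    (hG : Splus G k ≤ (numEdges G : ℝ) + k * (k + 1) / 2)
    (hH : Splus H k ≤ (numEdges H : ℝ) + k * (k + 1) / 2) :
    Splus (G ⊕g H) k ≤ (numEdges (G ⊕g H) : ℝ) + k * (k + 1) / 2 := by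
  obtain ⟨T, hT, hTk, hTs⟩ :=
    exists_le_map_sum_eq_sumKLargest (signlessLap_isHermitian (G ⊕g H)).eigenvalues k
  change T ≤ signlessSpectrum (G ⊕g H) at hT
  rw [signlessSpectrum_sum] at hT
  obtain ⟨A, B, hA, hB, rfl⟩ : ∃ A B, A ≤ signlessSpectrum G ∧ B ≤ signlessSpectrum H ∧
      A + B = T :=
    ⟨T ∩ signlessSpectrum G, T - signlessSpectrum G, Multiset.inter_le_right,
      Multiset.sub_le_iff_le_add'.2 hT, by rw [add_comm, Multiset.sub_add_inter]⟩
  rw [Splus, ← hTs, numEdges_sum, Multiset.sum_add]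
  rw [Multiset.card_add] at hTk
  push_cast
  have heG : (0 : ℝ) ≤ numEdges G := Nat.cast_nonneg _
  have heH : (0 : ℝ) ≤ numEdges H := Nat.cast_nonneg _
  rcases Nat.eq_zero_or_pos A.card with hA0 | hA0
  · obtain rfl := Multiset.card_eq_zero.1 hA0
    have : B.sum ≤ Splus H k :=
      sum_le_sumKLargest (eigenvalues_signlessLap_nonneg H) hB (by omega)
    rw [Multiset.sum_zero]
    linarith
  rcases Nat.eq_zero_or_pos B.card with hB0 | hB0
  · obtain rfl := Multiset.card_eq_zero.1 hB0
    have : A.sum ≤ Splus G k :=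
      sum_le_sumKLargest (eigenvalues_signlessLap_nonneg G) hA (by omega)
    rw [Multiset.sum_zero]
    linarith
  have hAs := sum_le_of_le_signlessSpectrum hA
  have hBs := sum_le_of_le_signlessSpectrum hB
  have hA1 : (1 : ℝ) ≤ A.card := by exact_mod_cast hA0
  have hB1 : (1 : ℝ) ≤ B.card := by exact_mod_cast hB0
  have hk : (A.card : ℝ) + B.card ≤ k := by exact_mod_cast hTk
  nlinarith [mul_nonneg (sub_nonneg.2 hA1) (sub_nonneg.2 hB1)]
end
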